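/- Let q ≥ 7 be a prime power, F a finite field with q^2 elements, G ∈ F[x_0,...,x_4] a nonzero homogeneous polynomial of degree 3, and P ∈ V(G)(F) ∩ V_3. Suppose there exists a plane Π of ℙ^4(F) with Π ⊆ T_P(V_3) and P ∉ Π such that: (i) there are an injective F-linear map φ : F^3 → F^5 whose image is the 3-dimensional subspace defining Π, and the homogeneous cubic g(y_0,y_1,y_2) = G(φ(y_0,y_1,y_2)) ∈ F[y_0,y_1,y_2] is irreducible over an algebraic closure of F (i.e., the plane cubic curve V(G) ∩ Π is absolutely irreducible); and (ii) V(G)(F) ∩ T_P(V_3) = {P} ∪ ⋃_{s ∈ C*} ℓ(P,s), where C* = V(G)(F) ∩ Π and ℓ(P,s) denotes the line of ℙ^4(F) through P and s (i.e., V(G) ∩ T_P(V_3) is the cone over C* with center P). Then there exists a line ℓ of ℙ^4(F) with P ∈ ℓ, ℓ ⊆ V(G)(F), and ℓ ∩ V_3 = {P} (a line of V(G) tangent to V_3 at P). -/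

import Mathlib

open MvPolynomial

noncomputable section

/-- The projective space ℙ⁴(F): 1-dimensional F-linear subspaces of F⁵. -/
abbrev P4 (F : Type) [Field F] := Projectivization F (Fin 5 → F)

/-- The non-degenerate Hermitian threefold
    V₃ = {[x] ∈ ℙ⁴(F) : x₀^{q+1} + ⋯ + x₄^{q+1} = 0}. -/
def hermV3 (q : ℕ) (F : Type) [Field F] : Set (P4 F) :=
  {x | ∑ i, x.rep i ^ (q + 1) = 0}

/-- V(G)(F) = {[x] ∈ ℙ⁴(F) : G(x) = 0}, for G homogeneous this is well defined. -/
def VG {F : Type} [Field F] (G : MvPolynomial (Fin 5) F) : Set (P4 F) :=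
  {x | eval x.rep G = 0}

/-- The set of points of ℙ⁴(F) contained in an F-linear subspace of F⁵ of dimension k. -/
def IsLinSub (F : Type) [Field F] (k : ℕ) (S : Set (P4 F)) : Prop :=
  ∃ W : Submodule F (Fin 5 → F), Module.finrank F W = k ∧
    S = {x : P4 F | x.submodule ≤ W}

/-- A line of ℙ⁴(F). -/
def IsLine (F : Type) [Field F] (S : Set (P4 F)) : Prop := IsLinSub F 2 S

/-- A plane of ℙ⁴(F). -/
def IsPlane (F : Type) [Field F] (S : Set (P4 F)) : Prop := IsLinSub F 3 S

/-- A hyperplane of ℙ⁴(F). -/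
def IsHyperplane (F : Type) [Field F] (S : Set (P4 F)) : Prop := IsLinSub F 4 S

/-- The tangent hyperplane T_P(V₃) = {[x] : a₀^q x₀ + ⋯ + a₄^q x₄ = 0} where P = [a]. -/
def tangentHyp (q : ℕ) {F : Type} [Field F] (P : P4 F) : Set (P4 F) :=
  {x | ∑ i, P.rep i ^ q * x.rep i = 0}

/-- A subset of ℙ⁴(F) is a tangent hyperplane to V₃ if it equals T_P(V₃) for some P ∈ V₃. -/
def IsTangentHyp (q : ℕ) {F : Type} [Field F] (S : Set (P4 F)) : Prop :=
  ∃ P ∈ hermV3 q F, S = tangentHyp q P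

/-- The line of ℙ⁴(F) through two (distinct) points P and s. -/
def lineThrough {F : Type} [Field F] (P s : P4 F) : Set (P4 F) :=
  {x : P4 F | x.submodule ≤ P.submodule ⊔ s.submodule}

/-- The ternary cubic form with coefficients `c`, evaluated at `u`. -/
def cub {R S : Type*} [CommRing R] [CommRing S] [Algebra R S] (c : Fin 10 → R)
    (u : Fin 3 → S) : S :=
  algebraMap R S (c 0) * u 0 ^ 3 + algebraMap R S (c 1) * u 0 ^ 2 * u 1
    + algebraMap R S (c 2) * u 0 ^ 2 * u 2 + algebraMap R S (c 3) * u 0 * u 1 ^ 2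
    + algebraMap R S (c 4) * u 0 * u 1 * u 2 + algebraMap R S (c 5) * u 0 * u 2 ^ 2
    + algebraMap R S (c 6) * u 1 ^ 3 + algebraMap R S (c 7) * u 1 ^ 2 * u 2
    + algebraMap R S (c 8) * u 1 * u 2 ^ 2 + algebraMap R S (c 9) * u 2 ^ 3

/-- The derivative of `cub c` at `u` in the direction `v`. -/
def cubD {R S : Type*} [CommRing R] [CommRing S] [Algebra R S] (c : Fin 10 → R)
    (u v : Fin 3 → S) : S :=
  (3 * algebraMap R S (c 0) * u 0 ^ 2 + 2 * algebraMap R S (c 1) * u 0 * u 1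
    + 2 * algebraMap R S (c 2) * u 0 * u 2 + algebraMap R S (c 3) * u 1 ^ 2
    + algebraMap R S (c 4) * u 1 * u 2 + algebraMap R S (c 5) * u 2 ^ 2) * v 0
  + (algebraMap R S (c 1) * u 0 ^ 2 + 2 * algebraMap R S (c 3) * u 0 * u 1
    + algebraMap R S (c 4) * u 0 * u 2 + 3 * algebraMap R S (c 6) * u 1 ^ 2
    + 2 * algebraMap R S (c 7) * u 1 * u 2 + algebraMap R S (c 8) * u 2 ^ 2) * v 1
  + (algebraMap R S (c 2) * u 0 ^ 2 + algebraMap R S (c 4) * u 0 * u 1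
    + 2 * algebraMap R S (c 5) * u 0 * u 2 + algebraMap R S (c 7) * u 1 ^ 2
    + 2 * algebraMap R S (c 8) * u 1 * u 2 + 3 * algebraMap R S (c 9) * u 2 ^ 2) * v 2

section
variable {R S T : Type*} [CommRing R] [CommRing S] [Algebra R S] [CommRing T] [Algebra R T]
  (c : Fin 10 → R)

theorem map_cub (f : S →ₐ[R] T) (u : Fin 3 → S) : f (cub c u) = cub c (fun i => f (u i)) := by
  simp [cub]

theorem map_cubD (f : S →ₐ[R] T) (u v : Fin 3 → S) :
    f (cubD c u v) = cubD c (fun i => f (u i)) (fun i => f (v i)) := by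
  have h2 : f 2 = 2 := map_ofNat f 2
  have h3 : f 3 = 3 := map_ofNat f 3
  simp [cubD, h2, h3]

theorem cub_comb (u v : Fin 3 → S) (s t : S) :
    cub c (s • u + t • v) =
      s ^ 3 * cub c u + s ^ 2 * t * cubD c u v + s * t ^ 2 * cubD c v u + t ^ 3 * cub c v := by
  simp [cub, cubD]; ring

theorem cubD_self (u : Fin 3 → S) : cubD c u u = 3 * cub c u := by
  simp [cub, cubD]; ring

theorem cubD_comb_right (u v w : Fin 3 → S) (s t : S) :
    cubD c u (s • v + t • w) = s * cubD c u v + t * cubD c u w := by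
  simp [cubD]; ring

theorem cubD_smul_right (u v : Fin 3 → S) (s : S) : cubD c u (s • v) = s * cubD c u v := by
  simp [cubD]; ring

theorem cubD_smul_left (u v : Fin 3 → S) (s : S) : cubD c (s • u) v = s ^ 2 * cubD c u v := by
  simp [cubD]; ring

theorem cub_smul (u : Fin 3 → S) (s : S) : cub c (s • u) = s ^ 3 * cub c u := by
  simp [cub]; ring

theorem cubD_comb_self (u v : Fin 3 → S) (s t : S) :
    cubD c (s • u + t • v) u =
      3 * s ^ 2 * cub c u + 2 * s * t * cubD c u v + t ^ 2 * cubD c v u := by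
  simp [cub, cubD]; ring

end

/-- Two vectors of length three are linearly dependent. -/
def Par {S : Type*} [CommRing S] (u v : Fin 3 → S) : Prop :=
  u 0 * v 1 = u 1 * v 0 ∧ u 0 * v 2 = u 2 * v 0 ∧ u 1 * v 2 = u 2 * v 1

theorem Par.exists_smul {K : Type*} [Field K] {u v : Fin 3 → K} (h : Par u v) (hv : v ≠ 0) :
    ∃ k : K, u = k • v := by
  obtain ⟨h1, h2, h3⟩ := h
  obtain ⟨i, hi⟩ := Function.ne_iff.mp hv
  simp only [Pi.zero_apply] at hi
  refine ⟨u i / v i, ?_⟩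
  ext j
  simp only [Pi.smul_apply, smul_eq_mul]
  fin_cases i <;> fin_cases j <;> simp at hi ⊢ <;> field_simp <;>
    first
    | linear_combination h1
    | linear_combination -h1
    | linear_combination h2
    | linear_combination -h2
    | linear_combination h3
    | linear_combination -h3

theorem Par.smul_left {S : Type*} [CommRing S] (v : Fin 3 → S) (k : S) : Par (k • v) v := by
  simp [Par]; refine ⟨?_, ?_, ?_⟩ <;> ring

theorem exists_comb_of_cross {K : Type*} [Field K] {u v : Fin 3 → K} (h : ¬ Par u v)
    (w : Fin 3 → K)
    (hw : (u 1 * v 2 - u 2 * v 1) * w 0 + (u 2 * v 0 - u 0 * v 2) * w 1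
      + (u 0 * v 1 - u 1 * v 0) * w 2 = 0) :
    ∃ a b : K, w = a • u + b • v := by
  by_cases h0 : u 1 * v 2 - u 2 * v 1 = 0
  · by_cases h1 : u 2 * v 0 - u 0 * v 2 = 0
    · have h2 : u 0 * v 1 - u 1 * v 0 ≠ 0 := fun h2 => h
        ⟨sub_eq_zero.mp h2, (sub_eq_zero.mp h1).symm, sub_eq_zero.mp h0⟩
      refine ⟨(w 0 * v 1 - w 1 * v 0) / (u 0 * v 1 - u 1 * v 0),
        (u 0 * w 1 - u 1 * w 0) / (u 0 * v 1 - u 1 * v 0), ?_⟩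
      ext j
      simp only [Pi.add_apply, Pi.smul_apply, smul_eq_mul, div_mul_eq_mul_div, ← add_div,
        eq_div_iff h2]
      fin_cases j <;> simp <;> first | ring1 | linear_combination hw
    · refine ⟨(w 2 * v 0 - w 0 * v 2) / (u 2 * v 0 - u 0 * v 2),
        (u 2 * w 0 - u 0 * w 2) / (u 2 * v 0 - u 0 * v 2), ?_⟩
      ext j
      simp only [Pi.add_apply, Pi.smul_apply, smul_eq_mul, div_mul_eq_mul_div, ← add_div,
        eq_div_iff h1]
      fin_cases j <;> simp <;> first | ring1 | linear_combination hw
  · refine ⟨(w 1 * v 2 - w 2 * v 1) / (u 1 * v 2 - u 2 * v 1),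
        (u 1 * w 2 - u 2 * w 1) / (u 1 * v 2 - u 2 * v 1), ?_⟩
    ext j
    simp only [Pi.add_apply, Pi.smul_apply, smul_eq_mul, div_mul_eq_mul_div, ← add_div,
      eq_div_iff h0]
    fin_cases j <;> simp <;> first | ring1 | linear_combination hw

/-- The plane cubic curve of `c` contains no line over `K`. -/
def NoLine {F : Type*} [Field F] (K : Type*) [Field K] [Algebra F K] (c : Fin 10 → F) : Prop :=
  ∀ u v : Fin 3 → K, cub c u = 0 → cub c v = 0 → cubD c u v = 0 → cubD c v u = 0 → Par u v

theorem NoLine.of_irreducible {F K : Type*} [Field F] [Field K] [Algebra F K] [IsAlgClosed K]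
    (c : Fin 10 → F) (h : Irreducible (cub c (X : Fin 3 → MvPolynomial (Fin 3) K)))
    (hd : (cub c (X : Fin 3 → MvPolynomial (Fin 3) K)).IsHomogeneous 3) : NoLine K c := by
  intro u v hu hv huv hvu
  by_contra hpar
  set g := cub c (X : Fin 3 → MvPolynomial (Fin 3) K) with hg
  set n : Fin 3 → K :=
    ![u 1 * v 2 - u 2 * v 1, u 2 * v 0 - u 0 * v 2, u 0 * v 1 - u 1 * v 0] with hn
  set l : MvPolynomial (Fin 3) K := C (n 0) * X 0 + C (n 1) * X 1 + C (n 2) * X 2 with hl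
  have hgev : ∀ w : Fin 3 → K, aeval w g = cub c w := fun w => by
    have := map_cub c ((aeval w : MvPolynomial (Fin 3) K →ₐ[K] K).restrictScalars F) X
    simpa using this
  have hmem : g ∈ vanishingIdeal K (zeroLocus K (Ideal.span {l})) := by
    rw [mem_vanishingIdeal_iff]
    intro w hw
    rw [mem_zeroLocus_iff] at hw
    have h1 := hw l (Ideal.mem_span_singleton_self l)
    simp [hl, hn] at h1
    obtain ⟨a, b, rfl⟩ := exists_comb_of_cross hpar w h1
    rw [hgev, cub_comb, hu, hv, huv, hvu]; ring
  rw [vanishingIdeal_zeroLocus_eq_radical] at hmem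
  obtain ⟨k, hk⟩ := hmem
  rw [Ideal.mem_span_singleton] at hk
  have hl0 : l ≠ 0 := by
    intro hl0
    have key : ∀ i, n i = 0 := by
      intro i
      have := congrArg (eval (Pi.single i 1)) hl0
      fin_cases i <;> simpa [hl] using this
    apply hpar
    have := key 0; have := key 1; have := key 2
    simp [hn] at *
    refine ⟨?_, ?_, ?_⟩ <;> grind
  have hlh : l.IsHomogeneous 1 := by
    have : ∀ i, (C (n i) * X i : MvPolynomial (Fin 3) K).IsHomogeneous 1 := fun i => by
      simpa using (isHomogeneous_C (Fin 3) (n i)).mul (isHomogeneous_X K i)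
    exact ((this 0).add (this 1)).add (this 2)
  have hlu : ¬ IsUnit l := by
    intro hu
    have := hu.map (eval (0 : Fin 3 → K))
    simp [hl] at this
  obtain ⟨p, hp, hpl⟩ := WfDvdMonoid.exists_irreducible_factor hlu hl0
  have hpg : p ∣ g := hp.prime.dvd_of_dvd_pow (hpl.trans hk)
  have hgl : g ∣ l := ((hp.associated_of_dvd h hpg).symm.dvd).trans hpl
  obtain ⟨m, hm⟩ := hgl
  have hm0 : m ≠ 0 := by rintro rfl; simp at hm; exact hl0 hm
  have := totalDegree_mul_of_isDomain h.ne_zero hm0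
  rw [← hm, hlh.totalDegree hl0, hd.totalDegree h.ne_zero] at this
  omega

theorem exists_frobenius_algebra (q : ℕ) (hq : IsPrimePow q) (F : Type*) [Field F] [Fintype F]
    (hF : Fintype.card F = q ^ 2) (A : Type*) [CommRing A] [Nontrivial A] [Algebra F A] :
    ∃ σ : A →+* A, ∀ x, σ x = x ^ q := by
  obtain ⟨p, n, hp, hn, rfl⟩ := hq
  have : Fact p.Prime := ⟨hp.nat_prime⟩
  obtain ⟨r, hr⟩ := CharP.exists F
  have hr' : r.Prime := (CharP.char_is_prime_or_zero F r).resolve_right fun h => by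
    subst h
    have := CharP.charP_to_charZero F
    exact (not_finite F)
  have hrp : r = p := by
    have : (r : ℕ) ∣ Fintype.card F := by
      rw [← CharP.cast_eq_zero_iff F r]; exact Nat.cast_card_eq_zero F
    rw [hF, ← pow_mul] at this
    exact (Nat.prime_dvd_prime_iff_eq hr' hp.nat_prime).mp (hr'.dvd_of_dvd_pow this)
  subst hrp
  have : CharP A r := charP_of_injective_algebraMap (algebraMap F A).injective r
  exact ⟨iterateFrobenius A r n, fun x => iterateFrobenius_def ..⟩

theorem exists_algebraMap_eq_of_pow_card {F K : Type*} [Field F] [Fintype F] [Field K] [Algebra F K]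
    (x : K) (hx : x ^ Fintype.card F = x) : ∃ a : F, algebraMap F K a = x := by
  classical
  by_contra! h
  have h1 := Fintype.one_lt_card (α := F)
  have hne : (Polynomial.X ^ Fintype.card F - Polynomial.X : Polynomial K) ≠ 0 :=
    FiniteField.X_pow_card_sub_X_ne_zero K h1
  have hsub : insert x (Finset.univ.image (algebraMap F K)) ⊆
      (Polynomial.X ^ Fintype.card F - Polynomial.X : Polynomial K).roots.toFinset := by
    intro y hy
    rw [Multiset.mem_toFinset, Polynomial.mem_roots hne]
    simp only [Finset.mem_insert, Finset.mem_image, Finset.mem_univ, true_and] at hy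
    rcases hy with rfl | ⟨a, rfl⟩
    · simp [hx]
    · simp [← map_pow, FiniteField.pow_card]
  have h2 := (Finset.card_le_card hsub).trans (Multiset.toFinset_card_le _) |>.trans
    (Polynomial.card_roots' _)
  rw [FiniteField.X_pow_card_sub_X_natDegree_eq K h1,
    Finset.card_insert_of_notMem (by simpa using h),
    Finset.card_image_of_injective _ (algebraMap F K).injective, Finset.card_univ] at h2
  omega

namespace WeierstrassCurve.Affine.CoordinateRing

variable {F : Type*} [Field F] (W : WeierstrassCurve.Affine F)

/-- The function `p + r * Y`. -/
def el (p r : Polynomial F) : W.CoordinateRing := p • (1 : W.CoordinateRing) + r • mk W Polynomial.X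

variable {W}

theorem norm_eq_zero {f : W.CoordinateRing} : Algebra.norm (Polynomial F) f = 0 ↔ f = 0 := by
  have := Module.Finite.of_basis (CoordinateRing.basis W)
  exact Algebra.norm_eq_zero_iff

/-- The pole order at infinity. -/
def poleDeg (f : W.CoordinateRing) : WithBot ℕ := (Algebra.norm (Polynomial F) f).degree

theorem poleDeg_el (p r : Polynomial F) :
    poleDeg (el W p r) = max (2 • p.degree) (2 • r.degree + 3) :=
  degree_norm_smul_basis p r

theorem exists_el (f : W.CoordinateRing) : ∃ p r, f = el W p r := by
  obtain ⟨p, r, h⟩ := exists_smul_basis_eq f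
  exact ⟨p, r, h.symm⟩

theorem el_add (p r p' r' : Polynomial F) : el W p r + el W p' r' = el W (p + p') (r + r') := by
  simp only [el, add_smul]; abel

theorem poleDeg_mul (f g : W.CoordinateRing) : poleDeg (f * g) = poleDeg f + poleDeg g := by
  simp [poleDeg, Polynomial.degree_mul]

theorem poleDeg_pow (f : W.CoordinateRing) (n : ℕ) : poleDeg (f ^ n) = n • poleDeg f := by
  simp [poleDeg, Polynomial.degree_pow]

theorem poleDeg_eq_bot {f : W.CoordinateRing} : poleDeg f = ⊥ ↔ f = 0 := by
  rw [poleDeg, Polynomial.degree_eq_bot, norm_eq_zero]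

theorem poleDeg_add_le (f g : W.CoordinateRing) :
    poleDeg (f + g) ≤ max (poleDeg f) (poleDeg g) := by
  obtain ⟨p, r, rfl⟩ := exists_el f
  obtain ⟨p', r', rfl⟩ := exists_el g
  have h2 : Monotone fun x : WithBot ℕ => 2 • x := fun a b h => nsmul_le_nsmul_right h 2
  rw [el_add, poleDeg_el, poleDeg_el, poleDeg_el]
  have h1 : ∀ a b : Polynomial F, 2 • (a + b).degree ≤ max (2 • a.degree) (2 • b.degree) :=
    fun a b => (h2 (Polynomial.degree_add_le a b)).trans h2.map_max.le
  have h3 : ∀ a b : Polynomial F,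
      2 • (a + b).degree + 3 ≤ max (2 • a.degree + 3) (2 • b.degree + 3) := fun a b =>
    (add_le_add_left (h1 a b) 3).trans_eq (max_add_add_right _ _ _).symm
  refine max_le ((h1 p p').trans ?_) ((h3 r r').trans ?_)
  · exact max_le_max (le_max_left _ _) (le_max_left _ _)
  · exact max_le_max (le_max_right _ _) (le_max_right _ _)

theorem poleDeg_neg (f : W.CoordinateRing) : poleDeg (-f) = poleDeg f := by
  obtain ⟨p, r, rfl⟩ := exists_el f
  have : -el W p r = el W (-p) (-r) := by simp [el]; abel
  rw [this, poleDeg_el, poleDeg_el, Polynomial.degree_neg, Polynomial.degree_neg]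

theorem poleDeg_sum_lt {ι : Type*} (s : Finset ι) (h : ι → W.CoordinateRing) (n : ℕ)
    (hn : ∀ i ∈ s, poleDeg (h i) < n) : poleDeg (∑ i ∈ s, h i) < n :=
  Finset.sum_induction h (fun f => poleDeg f < n)
    (fun a b ha hb => (poleDeg_add_le a b).trans_lt (max_lt ha hb))
    (by rw [poleDeg_eq_bot.mpr rfl]; exact WithBot.bot_lt_coe n) hn

theorem poleDeg_sum_le {ι : Type*} (s : Finset ι) (h : ι → W.CoordinateRing) (n : ℕ)
    (hn : ∀ i ∈ s, poleDeg (h i) ≤ n) : poleDeg (∑ i ∈ s, h i) ≤ n :=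
  Finset.sum_induction h (fun f => poleDeg f ≤ n)
    (fun a b ha hb => (poleDeg_add_le a b).trans (max_le ha hb))
    (by rw [poleDeg_eq_bot.mpr rfl]; exact bot_le) hn

theorem sum_ne_zero_of_poleDeg {ι : Type*} (s : Finset ι) (hs : s.Nonempty)
    (h : ι → W.CoordinateRing) (n : ι → ℕ) (hn : ∀ i ∈ s, poleDeg (h i) = n i)
    (hinj : Set.InjOn n s) : ∑ i ∈ s, h i ≠ 0 := by
  classical
  intro h0
  obtain ⟨i, hi, hmax⟩ := s.exists_max_image n hs
  rw [← Finset.add_sum_erase s h hi, add_eq_zero_iff_eq_neg] at h0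
  have h1 : poleDeg (∑ j ∈ s.erase i, h j) < n i := poleDeg_sum_lt _ _ _ fun j hj => by
    have hj' := Finset.mem_of_mem_erase hj
    rw [hn j hj']
    exact_mod_cast lt_of_le_of_ne (hmax j hj')
      fun he => Finset.ne_of_mem_erase hj (hinj hj' hi he)
  rw [← poleDeg_neg, ← h0, hn i hi] at h1
  exact lt_irrefl _ h1

theorem poleDeg_algebraMap {a : F} (ha : a ≠ 0) :
    poleDeg (algebraMap F W.CoordinateRing a) = 0 := by
  have : algebraMap F W.CoordinateRing a = el W (Polynomial.C a) 0 := by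
    rw [el, zero_smul, add_zero, IsScalarTower.algebraMap_apply F (Polynomial F),
      Algebra.algebraMap_eq_smul_one]; rfl
  rw [this, poleDeg_el]
  simp [Polynomial.degree_C ha]

section eval
variable {K : Type*} [Field K] [Algebra F K]

/-- `(x, y)` lies on the curve. -/
def On (W : WeierstrassCurve.Affine F) (x : F) (y : K) : Prop :=
  y ^ 2 + algebraMap F K (W.a₁ * x + W.a₃) * y
    = algebraMap F K (x ^ 3 + W.a₂ * x ^ 2 + W.a₄ * x + W.a₆)

/-- Evaluation at a point of the curve. -/
def ev {x : F} {y : K} (h : On W x y) : W.CoordinateRing →+* K :=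
  AdjoinRoot.lift ((algebraMap F K).comp (Polynomial.evalRingHom x)) y (by
    simp only [On] at h
    simp [WeierstrassCurve.Affine.polynomial, Polynomial.eval₂_add, Polynomial.eval₂_mul,
      Polynomial.eval₂_pow] at h ⊢
    linear_combination h)

theorem ev_el {x : F} {y : K} (h : On W x y) (p r : Polynomial F) :
    ev h (el W p r) = algebraMap F K (p.eval x) + algebraMap F K (r.eval x) * y := by
  simp [el, ev, smul]

theorem ev_algebraMap {x : F} {y : K} (h : On W x y) (a : F) :
    ev h (algebraMap F W.CoordinateRing a) = algebraMap F K a := by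
  have : algebraMap F W.CoordinateRing a = el W (Polynomial.C a) 0 := by
    rw [el, zero_smul, add_zero, IsScalarTower.algebraMap_apply F (Polynomial F),
      Algebra.algebraMap_eq_smul_one]; rfl
  simp [this, ev_el]

theorem On.eq_or {x : F} {y z : K} (hy : On W x y) (hz : On W x z) :
    z = y ∨ z = -y - algebraMap F K (W.a₁ * x + W.a₃) := by
  have : (z - y) * (z - (-y - algebraMap F K (W.a₁ * x + W.a₃))) = 0 := by
    simp only [On] at hy hz
    linear_combination hz - hy
  rcases mul_eq_zero.mp this with h | h
  · exact Or.inl (sub_eq_zero.mp h)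
  · exact Or.inr (sub_eq_zero.mp h)

theorem card_le_rootMultiplicity {f : W.CoordinateRing} (hf : f ≠ 0) (x : F) (S : Finset K)
    (hS : ∀ y ∈ S, ∃ h : On W x y, ev h f = 0) :
    S.card ≤ (Algebra.norm (Polynomial F) f).rootMultiplicity x := by
  classical
  have hN : Algebra.norm (Polynomial F) f ≠ 0 := by rwa [Ne, norm_eq_zero]
  obtain ⟨p, r, rfl⟩ := exists_el f
  have hnorm := norm_smul_basis (W' := W) p r
  rw [← el] at hnorm
  by_cases h2 : ∃ y ∈ S, ∃ z ∈ S, y ≠ z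
  · obtain ⟨y, hy, z, hz, hyz⟩ := h2
    obtain ⟨hy1, hy2⟩ := hS y hy
    obtain ⟨hz1, hz2⟩ := hS z hz
    have hsub : S ⊆ {y, z} := by
      intro w hw
      have h1 := (hy1.eq_or hz1).resolve_left hyz.symm
      have h3 := hy1.eq_or (hS w hw).1
      rw [← h1] at h3
      simpa using h3
    rw [ev_el] at hy2 hz2
    have hr : r.eval x = 0 := by
      have : algebraMap F K (r.eval x) * (y - z) = 0 := by linear_combination hy2 - hz2
      simpa [sub_ne_zero.mpr hyz] using this
    have hp : p.eval x = 0 := by simpa [hr] using hy2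
    refine (Finset.card_le_card hsub).trans (Finset.card_le_two.trans ?_)
    rw [Polynomial.le_rootMultiplicity_iff hN, hnorm]
    obtain ⟨p', hp'⟩ := Polynomial.dvd_iff_isRoot.mpr hp
    obtain ⟨r', hr'⟩ := Polynomial.dvd_iff_isRoot.mpr hr
    refine ⟨p' ^ 2 - p' * r' * (Polynomial.C W.a₁ * Polynomial.X + Polynomial.C W.a₃) -
      r' ^ 2 * (Polynomial.X ^ 3 + Polynomial.C W.a₂ * Polynomial.X ^ 2
        + Polynomial.C W.a₄ * Polynomial.X + Polynomial.C W.a₆), ?_⟩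
    rw [hp', hr']; ring
  · push Not at h2
    have h1 : S.card ≤ 1 := Finset.card_le_one.mpr h2
    rcases S.eq_empty_or_nonempty with rfl | ⟨y, hy⟩
    · simp
    · refine h1.trans (Nat.one_le_iff_ne_zero.mpr ?_)
      rw [← Nat.pos_iff_ne_zero, Polynomial.rootMultiplicity_pos hN, Polynomial.IsRoot.def, hnorm]
      obtain ⟨hy1, hy2⟩ := hS y hy
      rw [ev_el] at hy2
      apply (algebraMap F K).injective
      simp only [On, map_add, map_mul, map_pow] at hy1
      simp only [Polynomial.eval_sub, Polynomial.eval_mul, Polynomial.eval_add, Polynomial.eval_pow,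
        Polynomial.eval_C, Polynomial.eval_X, map_sub, map_add, map_mul, map_pow, map_zero]
      linear_combination (algebraMap F K (p.eval x) - algebraMap F K (r.eval x) * y
        - algebraMap F K (r.eval x) *
          (algebraMap F K W.a₁ * algebraMap F K x + algebraMap F K W.a₃)) * hy2
        + algebraMap F K (r.eval x) ^ 2 * hy1

theorem sum_card_le_natDegree [Fintype F] {f : W.CoordinateRing} (hf : f ≠ 0) (S : F → Finset K)
    (hS : ∀ x, ∀ y ∈ S x, ∃ h : On W x y, ev h f = 0) {n : ℕ} (hn : poleDeg f ≤ n) :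
    ∑ x, (S x).card ≤ n := by
  classical
  calc ∑ x, (S x).card ≤ ∑ x, (Algebra.norm (Polynomial F) f).roots.count x :=
        Finset.sum_le_sum fun x _ => by
          rw [Polynomial.count_roots]; exact card_le_rootMultiplicity hf x _ (hS x)
    _ = (Algebra.norm (Polynomial F) f).roots.card :=
        Multiset.sum_count_eq_card fun _ _ => Finset.mem_univ _
    _ ≤ (Algebra.norm (Polynomial F) f).natDegree := Polynomial.card_roots' _
    _ ≤ n := Polynomial.natDegree_le_iff_degree_le.mpr hn
end eval

variable (W)

/-- A monomial of pole order `n`, for `n ≠ 1`. -/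
def mon (n : ℕ) : W.CoordinateRing :=
  if Even n then el W (Polynomial.X ^ (n / 2)) 0 else el W 0 (Polynomial.X ^ ((n - 3) / 2))

/-- The image of `mon W n` under the negation of the curve. -/
def monBar (n : ℕ) : W.CoordinateRing :=
  if Even n then el W (Polynomial.X ^ (n / 2)) 0 else
    el W (-(Polynomial.X ^ ((n - 3) / 2) *
      (Polynomial.C W.a₁ * Polynomial.X + Polynomial.C W.a₃))) (-Polynomial.X ^ ((n - 3) / 2))

theorem poleDeg_mon {n : ℕ} (hn : n ≠ 1) : poleDeg (mon W n) = n := by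
  rw [mon]
  split_ifs with h
  · obtain ⟨k, rfl⟩ := h
    rw [poleDeg_el, ← two_mul, Nat.mul_div_cancel_left k two_pos]
    simp
  · obtain ⟨k, rfl⟩ := Nat.not_even_iff_odd.mp h
    obtain ⟨m, rfl⟩ : ∃ m, k = m + 1 := ⟨k - 1, by omega⟩
    rw [poleDeg_el, show (2 * (m + 1) + 1 - 3) / 2 = m by omega]
    simp
    norm_cast

theorem poleDeg_monBar {n : ℕ} (hn : n ≠ 1) : poleDeg (monBar W n) = n := by
  rw [monBar]
  split_ifs with h
  · obtain ⟨k, rfl⟩ := h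
    rw [poleDeg_el, ← two_mul, Nat.mul_div_cancel_left k two_pos]
    simp
  · obtain ⟨k, rfl⟩ := Nat.not_even_iff_odd.mp h
    obtain ⟨m, rfl⟩ : ∃ m, k = m + 1 := ⟨k - 1, by omega⟩
    rw [poleDeg_el, show (2 * (m + 1) + 1 - 3) / 2 = m by omega, Polynomial.degree_neg,
      Polynomial.degree_neg, max_eq_right]
    · simp
      norm_cast
    · have h1 : (Polynomial.X ^ m * (Polynomial.C W.a₁ * Polynomial.X + Polynomial.C W.a₃)).degree
          ≤ ((m + 1 : ℕ) : WithBot ℕ) := by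
        refine (Polynomial.degree_mul_le _ _).trans ?_
        rw [Polynomial.degree_X_pow]
        push_cast
        gcongr
        exact Polynomial.degree_linear_le
      refine (nsmul_le_nsmul_right h1 2).trans ?_
      rw [Polynomial.degree_X_pow]
      simp only [nsmul_eq_mul]
      norm_cast
      omega

theorem ev_monBar {K : Type*} [Field K] [Algebra F K] [Fintype F] (σ : K →+* K)
    (hσ : ∀ z, σ z = z ^ Fintype.card F) {x : F} {y : K} (h : On W x y)
    (hy : y ^ Fintype.card F = -y - algebraMap F K (W.a₁ * x + W.a₃)) (n : ℕ) :
    σ (ev h (mon W n)) = ev h (monBar W n) := by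
  have hx : ∀ a : F, σ (algebraMap F K a) = algebraMap F K a := fun a => by
    rw [hσ, ← map_pow, FiniteField.pow_card]
  rw [mon, monBar]
  split_ifs
  · simp [ev_el, hx]
  · rw [ev_el, ev_el, map_add, map_mul, hx, hx, hσ y, hy]
    simp
    ring

variable {W}

/-- The linear map `(p, r) ↦ p + r * Y`. -/
def elLin (W : WeierstrassCurve.Affine F) (m n : ℕ) :
    Polynomial.degreeLT F m × Polynomial.degreeLT F n →ₗ[F] W.CoordinateRing where
  toFun x := el W x.1 x.2
  map_add' x y := by simp [el_add]
  map_smul' a x := by simp [el]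

theorem mem_range_elLin {f : W.CoordinateRing} {n : ℕ} (hn : 3 ≤ n) (hf : poleDeg f ≤ n) :
    f ∈ LinearMap.range (elLin W (n / 2 + 1) ((n - 3) / 2 + 1)) := by
  obtain ⟨p, r, rfl⟩ := exists_el f
  rw [poleDeg_el, max_le_iff] at hf
  have h1 : p ∈ Polynomial.degreeLT F (n / 2 + 1) := by
    rw [Polynomial.mem_degreeLT]
    rcases eq_or_ne p 0 with rfl | hp
    · simp
    · have := hf.1
      rw [Polynomial.degree_eq_natDegree hp, nsmul_eq_mul] at this
      rw [Polynomial.degree_eq_natDegree hp]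
      norm_cast at this ⊢
      omega
  have h2 : r ∈ Polynomial.degreeLT F ((n - 3) / 2 + 1) := by
    rw [Polynomial.mem_degreeLT]
    rcases eq_or_ne r 0 with rfl | hr
    · simp
    · have := hf.2
      rw [Polynomial.degree_eq_natDegree hr, nsmul_eq_mul] at this
      rw [Polynomial.degree_eq_natDegree hr]
      norm_cast at this ⊢
      omega
  exact ⟨(⟨p, h1⟩, ⟨r, h2⟩), rfl⟩

theorem not_linearIndependent_of_poleDeg_le {ι : Type*} [Fintype ι] (g : ι → W.CoordinateRing)
    {n : ℕ} (hn : 3 ≤ n) (hg : ∀ i, poleDeg (g i) ≤ n) (hι : n < Fintype.card ι) :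
    ¬ LinearIndependent F g := by
  intro hli
  have hmem : ∀ i, g i ∈ LinearMap.range (elLin W (n / 2 + 1) ((n - 3) / 2 + 1)) := fun i =>
    mem_range_elLin hn (hg i)
  have h1 : LinearIndependent F (fun i => (⟨g i, hmem i⟩ :
      LinearMap.range (elLin W (n / 2 + 1) ((n - 3) / 2 + 1)))) :=
    LinearIndependent.of_comp (Submodule.subtype _) hli
  have : ∀ m, Module.finrank F (Polynomial.degreeLT F m) = m := fun m => by
    rw [(Polynomial.degreeLTEquiv F m).finrank_eq, Module.finrank_fin_fun]
  have : ∀ m, Module.Finite F (Polynomial.degreeLT F m) := fun m =>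
    Module.Finite.equiv (Polynomial.degreeLTEquiv F m).symm
  have h2 := h1.fintype_card_le_finrank.trans (LinearMap.finrank_range_le _)
  rw [Module.finrank_prod] at h2
  simp only [*] at h2
  omega

/-- Pairs of pole orders. -/
def orders (q : ℕ) : Finset (ℕ × ℕ) :=
  (insert 0 (Finset.Icc 2 (q + 1))) ×ˢ (insert 0 (Finset.Icc 2 (q - 1))) ∪
    {(q + 2, 0), (q + 2, 2), (q + 2, 3)}

theorem mem_orders {q : ℕ} (hq : 7 ≤ q) {x : ℕ × ℕ} (hx : x ∈ orders q) :
    x.1 ≠ 1 ∧ x.2 ≠ 1 ∧ x.2 < q ∧ x.1 ≤ q + 2 ∧ x.1 + q * x.2 ≤ q ^ 2 + 1 ∧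
      x.2 + q * x.1 ≤ q ^ 2 + 2 * q + 3 := by
  obtain ⟨i, j⟩ := x
  rw [orders, Finset.mem_union] at hx
  rcases hx with hx | hx <;> simp at hx
  · obtain ⟨hi, hj⟩ := hx
    have h1 : j ≤ q - 1 := by omega
    have h2 : i ≤ q + 1 := by omega
    obtain ⟨k, rfl⟩ : ∃ k, q = k + 1 := ⟨q - 1, by omega⟩
    refine ⟨by omega, by omega, by omega, by omega, ?_, ?_⟩ <;> simp at * <;> nlinarith
  · obtain ⟨k, rfl⟩ : ∃ k, q = k + 7 := ⟨q - 7, by omega⟩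
    rcases hx with ⟨rfl, rfl⟩ | ⟨rfl, rfl⟩ | ⟨rfl, rfl⟩ <;>
    refine ⟨by omega, by omega, by omega, by omega, ?_, ?_⟩ <;> simp at * <;> nlinarith

theorem card_orders {q : ℕ} (hq : 7 ≤ q) : (orders q).card = q ^ 2 + 2 := by
  rw [orders, Finset.card_union_of_disjoint, Finset.card_product, Finset.card_insert_of_notMem,
    Finset.card_insert_of_notMem, Nat.card_Icc, Nat.card_Icc]
  · obtain ⟨k, rfl⟩ : ∃ k, q = k + 7 := ⟨q - 7, by omega⟩
    simp
    ring
  · simp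
  · simp
  · rw [Finset.disjoint_left]
    simp
    omega

theorem sum_twisted_le (q : ℕ) (hq : IsPrimePow q) (hq7 : 7 ≤ q) [Fintype F]
    (hF : Fintype.card F = q ^ 2) {K : Type*} [Field K] [Algebra F K] (S : F → Finset K)
    (hS : ∀ x, ∀ y ∈ S x, On W x y ∧
      y ^ Fintype.card F = -y - algebraMap F K (W.a₁ * x + W.a₃)) :
    ∑ x, (S x).card ≤ q ^ 2 + 2 * q + 3 := by
  classical
  obtain ⟨σ, hσ⟩ := exists_frobenius_algebra q hq F hF K
  have hrel := not_linearIndependent_of_poleDeg_le (ι := orders q) (n := q ^ 2 + 1)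
    (fun x => mon W x.1.2 ^ q * monBar W x.1.1) (by nlinarith)
    (fun x => by
      obtain ⟨h1, h2, h3, h4, h5, h6⟩ := mem_orders hq7 x.2
      rw [poleDeg_mul, poleDeg_pow, poleDeg_mon W h2, poleDeg_monBar W h1, nsmul_eq_mul]
      norm_cast
      omega)
    (by rw [Fintype.card_coe, card_orders hq7]; omega)
  rw [Fintype.not_linearIndependent_iff] at hrel
  obtain ⟨d, hd, x₀, hx₀⟩ := hrel
  set h : orders q → W.CoordinateRing := fun x =>
    algebraMap F W.CoordinateRing (d x ^ q) * (mon W x.1.2 * mon W x.1.1 ^ q) with hh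
  have hpd : ∀ x ∈ Finset.univ.filter (fun x => d x ≠ 0),
      poleDeg (h x) = ((x.1.2 + q * x.1.1 : ℕ) : WithBot ℕ) := fun x hx => by
    obtain ⟨h1, h2, h3, h4, h5, h6⟩ := mem_orders hq7 x.2
    simp only [Finset.mem_filter, Finset.mem_univ, true_and] at hx
    rw [hh, poleDeg_mul, poleDeg_mul, poleDeg_pow, poleDeg_mon W h2, poleDeg_mon W h1,
      poleDeg_algebraMap (pow_ne_zero q hx)]
    simp
  have hsum : ∑ x, h x = ∑ x ∈ Finset.univ.filter (fun x => d x ≠ 0), h x := by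
    refine (Finset.sum_filter_of_ne (p := fun x => d x ≠ 0) fun x _ hx hdx => hx ?_).symm
    simp [hh, hdx, show q ≠ 0 by omega]
  have he : ∑ x, h x ≠ 0 := by
    rw [hsum]
    refine sum_ne_zero_of_poleDeg _ ⟨x₀, by simpa using hx₀⟩ _ _ hpd ?_
    intro x _ y _ hxy
    obtain ⟨h1, h2, h3, h4, h5, h6⟩ := mem_orders hq7 x.2
    obtain ⟨h1', h2', h3', h4', h5', h6'⟩ := mem_orders hq7 y.2
    have e1 := congrArg (· % q) hxy
    have e2 := congrArg (· / q) hxy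
    simp only [Nat.add_mul_mod_self_left, Nat.mod_eq_of_lt h3, Nat.mod_eq_of_lt h3'] at e1
    simp only [Nat.add_mul_div_left _ _ (show 0 < q by omega), Nat.div_eq_of_lt h3,
      Nat.div_eq_of_lt h3', zero_add] at e2
    exact Subtype.ext (Prod.ext e2 e1)
  refine sum_card_le_natDegree he S (fun x y hy => ?_)
    (?_ : _ ≤ ((q ^ 2 + 2 * q + 3 : ℕ) : WithBot ℕ))
  · obtain ⟨hon, hy⟩ := hS x y hy
    refine ⟨hon, ?_⟩
    have hσσ : ∀ z, (σ.comp σ) z = z ^ Fintype.card F := fun z => by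
      rw [RingHom.comp_apply, hσ, hσ, ← pow_mul, ← sq, hF]
    rw [← map_eq_zero σ, map_sum, map_sum, ← map_zero (ev hon), ← hd, map_sum]
    refine Finset.sum_congr rfl fun p _ => ?_
    have hdp : (d p ^ q) ^ q = d p := by
      rw [← pow_mul, ← sq, ← hF, FiniteField.pow_card]
    have := ev_monBar W (σ.comp σ) hσσ hon hy p.1.1
    rw [RingHom.comp_apply, hσ (ev hon _)] at this
    simp only [hh, Algebra.smul_def, map_mul, ev_algebraMap, map_pow, ← this]
    rw [← map_pow, ← map_pow (algebraMap F K), ← map_pow σ, hσ (algebraMap F K _),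
      ← map_pow (algebraMap F K),
      hdp, hσ (ev hon (mon W p.1.2))]
  · rw [hsum]
    refine poleDeg_sum_le _ _ _ fun x hx => ?_
    rw [hpd x hx]
    exact_mod_cast (mem_orders hq7 x.2).2.2.2.2.2

open Classical in
theorem card_le_sum_card (W : WeierstrassCurve.Affine F)
    (q : ℕ) (hq : IsPrimePow q) (hq7 : 7 ≤ q) [Fintype F]
    (hF : Fintype.card F = q ^ 2) (K : Type*) [Field K] [Algebra F K] [IsAlgClosed K] :
    q ^ 2 ≤ ∑ x : F, (Finset.univ.filter (fun y : F => On W x y)).card + (2 * q + 3) := by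
  set P : F → Polynomial K := fun x => Polynomial.X ^ 2
    + Polynomial.C (algebraMap F K (W.a₁ * x + W.a₃)) * Polynomial.X
    - Polynomial.C (algebraMap F K (x ^ 3 + W.a₂ * x ^ 2 + W.a₄ * x + W.a₆)) with hP
  have hPdeg : ∀ x, (P x).degree = 2 := fun x => by
    simp only [hP]; compute_degree!
  have hPmem : ∀ x y, y ∈ (P x).roots.toFinset ↔ On W x y := fun x y => by
    have : P x ≠ 0 := fun h => by have := hPdeg x; simp [h] at this
    rw [Multiset.mem_toFinset, Polynomial.mem_roots this, Polynomial.IsRoot.def, On]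
    simp only [hP, Polynomial.eval_sub, Polynomial.eval_add, Polynomial.eval_mul,
      Polynomial.eval_pow, Polynomial.eval_X, Polynomial.eval_C, sub_eq_zero]
  set B : F → Finset K := fun x => (P x).roots.toFinset.filter
    fun y => y ^ Fintype.card F = -y - algebraMap F K (W.a₁ * x + W.a₃) with hB
  have hBle := sum_twisted_le (W := W) q hq hq7 hF B fun x y hy => by
    simp only [hB, Finset.mem_filter, hPmem] at hy
    exact hy
  have hσ := FiniteField.coe_frobeniusAlgHom F K
  have hOnF : ∀ x y : F, On W x (algebraMap F K y) ↔ On W x y := fun x y => by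
    simp only [On, Algebra.algebraMap_self, RingHom.id_apply]
    rw [← map_pow, ← map_mul, ← map_add, (algebraMap F K).injective.eq_iff]
  have key : ∀ x : F, 2 ≤ (Finset.univ.filter (fun y : F => On W x y)).card + (B x).card := by
    intro x
    obtain ⟨r, hr⟩ := IsAlgClosed.exists_root (P x) (by rw [hPdeg]; decide)
    have hr : On W x r := (hPmem x r).mp (by
      rw [Multiset.mem_toFinset, Polynomial.mem_roots]; exact hr
      exact fun h => by have := hPdeg x; simp [h] at this)
    set r' := -r - algebraMap F K (W.a₁ * x + W.a₃) with hr'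
    have hr'On : On W x r' := by
      simp only [On] at hr ⊢
      rw [hr']; linear_combination hr
    set τ := FiniteField.frobeniusAlgHom F K
    have hτ : ∀ z, τ z = z ^ Fintype.card F := fun z => congrFun hσ z
    have hrQ : On W x (r ^ Fintype.card F) := by
      have := congrArg τ (show _ = _ from hr)
      simp only [map_add, map_mul, map_pow, AlgHom.commutes] at this
      simp only [On, map_add, map_mul, map_pow, ← hτ]
      exact this
    have hfix : ∀ z, On W x z → z ^ Fintype.card F = z → ∃ a : F, algebraMap F K a = z ∧
        a ∈ Finset.univ.filter (fun y : F => On W x y) := fun z hz hzQ => by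
      obtain ⟨a, rfl⟩ := exists_algebraMap_eq_of_pow_card z hzQ
      exact ⟨a, rfl, by simpa using (hOnF x a).mp hz⟩
    have hr'Q : r' ^ Fintype.card F = -r ^ Fintype.card F - algebraMap F K (W.a₁ * x + W.a₃) := by
      rw [← hτ, ← hτ, hr', map_sub, map_neg, AlgHom.commutes]
    by_cases h1 : r ^ Fintype.card F = r
    · obtain ⟨a, ha, haA⟩ := hfix r hr h1
      by_cases h2 : r = r'
      · have hrB : r ∈ B x := by
          rw [hB, Finset.mem_filter]
          exact ⟨(hPmem x r).mpr hr, by rw [h1]; exact h2⟩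
        have c1 := Finset.card_pos.mpr ⟨a, haA⟩
        have c2 := Finset.card_pos.mpr ⟨r, hrB⟩
        omega
      · obtain ⟨b, hb, hbA⟩ := hfix r' hr'On (by rw [hr'Q, h1])
        have : 1 < (Finset.univ.filter (fun y : F => On W x y)).card :=
          Finset.one_lt_card.mpr ⟨a, haA, b, hbA, by rintro rfl; exact h2 (ha.symm.trans hb)⟩
        omega
    · have h2 : r ^ Fintype.card F = r' := (hr.eq_or hrQ).resolve_left h1
      have m1 : r ∈ B x := by
        rw [hB, Finset.mem_filter]
        exact ⟨(hPmem x r).mpr hr, h2⟩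
      have m2 : r' ∈ B x := by
        rw [hB, Finset.mem_filter]
        exact ⟨(hPmem x r').mpr hr'On, by rw [hr'Q, h2]⟩
      have : 1 < (B x).card := Finset.one_lt_card.mpr ⟨r, m1, r', m2, fun h => h1 (h2.trans h.symm)⟩
      omega
  have h2 := Finset.sum_le_sum fun x (_ : x ∈ Finset.univ) => key x
  rw [Finset.sum_add_distrib, Finset.sum_const, Finset.card_univ, hF, smul_eq_mul] at h2
  omega

theorem exists_form_ne_zero (q : ℕ) (hq : IsPrimePow q) (hq7 : 7 ≤ q) [Fintype F]
    (hF : Fintype.card F = q ^ 2) (K : Type*) [Field K] [Algebra F K] [IsAlgClosed K]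
    (ξ : Fin 3 → W.CoordinateRing) (p : Fin 3 → ℕ) (hp : Function.Injective p)
    (hpq : ∀ i, p i < q) (hξ : ∀ i, poleDeg (ξ i) = p i) (a : Fin 3 → Fin 3 → F) (ha : a ≠ 0)
    (n : ℕ) (hn : ∀ i j, a i j ≠ 0 → p i + q * p j ≤ n) (hnq : n + (2 * q + 3) < q ^ 2) :
    ∃ x y : F, ∃ h : On W x y, ∑ i, ∑ j, a i j * ev h (ξ i) * ev h (ξ j) ^ q ≠ 0 := by
  classical
  by_contra! hcon
  set f : Fin 3 × Fin 3 → W.CoordinateRing := fun x =>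
    algebraMap F W.CoordinateRing (a x.1 x.2) * (ξ x.1 * ξ x.2 ^ q) with hf
  have hdeg : ∀ x ∈ Finset.univ.filter (fun x : Fin 3 × Fin 3 => a x.1 x.2 ≠ 0),
      poleDeg (f x) = ((p x.1 + q * p x.2 : ℕ) : WithBot ℕ) := fun x hx => by
    simp only [Finset.mem_filter, Finset.mem_univ, true_and] at hx
    rw [hf, poleDeg_mul, poleDeg_mul, poleDeg_pow, hξ, hξ, poleDeg_algebraMap hx]
    simp
  have hsum : ∑ x, f x =
      ∑ x ∈ Finset.univ.filter (fun x : Fin 3 × Fin 3 => a x.1 x.2 ≠ 0), f x := by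
    refine (Finset.sum_filter_of_ne (p := fun x : Fin 3 × Fin 3 => a x.1 x.2 ≠ 0)
      fun x _ hx hdx => hx ?_).symm
    simp [hf, hdx]
  have hne : ∑ x, f x ≠ 0 := by
    rw [hsum]
    refine sum_ne_zero_of_poleDeg _ ?_ _ _ hdeg ?_
    · by_contra h
      apply ha
      rw [Finset.not_nonempty_iff_eq_empty, Finset.filter_eq_empty_iff] at h
      ext i j
      simpa using h (Finset.mem_univ (i, j))
    · intro x _ y _ hxy
      have e1 := congrArg (· % q) hxy
      have e2 := congrArg (· / q) hxy
      simp only [Nat.add_mul_mod_self_left, Nat.mod_eq_of_lt (hpq _)] at e1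
      simp only [Nat.add_mul_div_left _ _ (show 0 < q by omega), Nat.div_eq_of_lt (hpq _),
        zero_add] at e2
      exact Prod.ext (hp e1) (hp e2)
  have hle : poleDeg (∑ x, f x) ≤ n := by
    rw [hsum]
    refine poleDeg_sum_le _ _ _ fun x hx => ?_
    rw [hdeg x hx]
    exact_mod_cast hn _ _ (by simpa using hx)
  have h1 := sum_card_le_natDegree hne (fun x => Finset.univ.filter (fun y : F => On W x y))
    (fun x y hy => ⟨by simpa using hy, by
      rw [map_sum, ← hcon x y (by simpa using hy), Fintype.sum_prod_type]
      simp only [hf, map_mul, ev_algebraMap, map_pow, Algebra.algebraMap_self, RingHom.id_apply,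
        mul_assoc]⟩) hle
  have h2 := card_le_sum_card W q hq hq7 hF K
  omega

theorem poleDeg_X_add_Y (k : F) (hk : k ≠ 0) :
    poleDeg (el W (Polynomial.C k * Polynomial.X) 0) = 2 ∧
    poleDeg (el W 0 (Polynomial.C k)) = 3 ∧ poleDeg (el W 1 0) = 0 := by
  simp [poleDeg_el, Polynomial.degree_C_mul_X hk, Polynomial.degree_C hk]

end WeierstrassCurve.Affine.CoordinateRing

open WeierstrassCurve.Affine.CoordinateRing

theorem exists_form_ne_zero_of_flex {F : Type*} [Field F] (q : ℕ) (hq : IsPrimePow q)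
    (hq7 : 7 ≤ q) [Fintype F]
    (hF : Fintype.card F = q ^ 2) (K : Type*) [Field K] [Algebra F K] [IsAlgClosed K]
    (c : Fin 10 → F) (h9 : c 9 = 0) (h5 : c 5 = 0) (h8 : c 8 = 1) (h2 : c 2 = 0) (h0 : c 0 ≠ 0)
    (a : Fin 3 → Fin 3 → F) (ha : a ≠ 0) :
    ∃ y : Fin 3 → F, cub c y = 0 ∧ ∑ i, ∑ j, a i j * y i * y j ^ q ≠ 0 := by
  set k := c 0
  set W : WeierstrassCurve.Affine F :=
    { a₁ := -c 4 / k, a₂ := -c 1 / k ^ 2, a₃ := c 7 / k ^ 2, a₄ := c 3 / k ^ 3, a₆ := -c 6 / k ^ 4 }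
    with hW
  obtain ⟨x, y, h, hne⟩ := exists_form_ne_zero q hq hq7 hF K
    ![el W (Polynomial.C (-k) * Polynomial.X) 0, el W 1 0, el W 0 (Polynomial.C (k ^ 2))]
    ![2, 0, 3] (by decide) (fun i => by fin_cases i <;> simp <;> omega)
    (fun i => by
      fin_cases i
      · exact (poleDeg_X_add_Y (-k) (neg_ne_zero.mpr h0)).1
      · exact (poleDeg_X_add_Y k h0).2.2
      · exact (poleDeg_X_add_Y (k ^ 2) (pow_ne_zero 2 h0)).2.1) a ha (3 * q + 3)
    (fun i j _ => by fin_cases i <;> fin_cases j <;> simp <;> omega) (by nlinarith)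
  refine ⟨fun i => ev h (![el W (Polynomial.C (-k) * Polynomial.X) 0, el W 1 0,
    el W 0 (Polynomial.C (k ^ 2))] i), ?_, hne⟩
  simp only [On, Algebra.algebraMap_self, RingHom.id_apply, hW] at h
  have h' := h
  field_simp at h'
  simp [cub, ev_el, h9, h5, h8, h2]
  linear_combination h'

theorem exists_form_ne_zero_of_not_flex {F : Type*} [Field F] (q : ℕ) (hq : IsPrimePow q)
    (hq7 : 7 ≤ q) [Fintype F]
    (hF : Fintype.card F = q ^ 2) (K : Type*) [Field K] [Algebra F K] [IsAlgClosed K]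
    (c : Fin 10 → F) (h9 : c 9 = 0) (h5 : c 5 = 0) (h8 : c 8 = 1) (h0 : c 0 = 0) (h1 : c 1 = 0)
    (h2 : c 2 ≠ 0) (a : Fin 3 → Fin 3 → F) (ha : a ≠ 0) :
    ∃ y : Fin 3 → F, cub c y = 0 ∧ ∑ i, ∑ j, a i j * y i * y j ^ q ≠ 0 := by
  by_cases ha2 : a 2 2 = 0
  swap
  · refine ⟨![0, 0, 1], by simp [cub, h9], ?_⟩
    simpa [Fin.sum_univ_three, show q ≠ 0 by omega] using ha2
  set k := c 2
  set W : WeierstrassCurve.Affine F :=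
    { a₁ := -c 4 / k, a₂ := -c 7 / k, a₃ := c 3 / k ^ 2, a₄ := c 6 / k ^ 2, a₆ := 0 }
    with hW
  obtain ⟨x, y, h, hne⟩ := exists_form_ne_zero q hq hq7 hF K
    ![el W 0 (Polynomial.C k), el W (Polynomial.C (-k) * Polynomial.X) 0,
      el W (Polynomial.C (-k) * Polynomial.X) 0 ^ 2]
    ![3, 2, 4] (by decide) (fun i => by fin_cases i <;> simp <;> omega)
    (fun i => by
      fin_cases i
      · exact (poleDeg_X_add_Y k h2).2.1
      · exact (poleDeg_X_add_Y (-k) (neg_ne_zero.mpr h2)).1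
      · simp only [Fin.reduceFinMk, Matrix.cons_val]
        rw [poleDeg_pow, (poleDeg_X_add_Y (-k) (neg_ne_zero.mpr h2)).1]
        norm_num) a ha (4 * q + 3)
    (fun i j hij => by
      fin_cases i <;> fin_cases j <;> simp <;> first | omega | exact absurd ha2 hij) (by nlinarith)
  refine ⟨fun i => ev h (![el W 0 (Polynomial.C k), el W (Polynomial.C (-k) * Polynomial.X) 0,
      el W (Polynomial.C (-k) * Polynomial.X) 0 ^ 2] i), ?_, hne⟩
  simp only [On, Algebra.algebraMap_self, RingHom.id_apply, hW] at h
  have h' := h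
  field_simp at h'
  simp [cub, ev_el, h9, h5, h8, h0, h1]
  linear_combination k ^ 3 * x ^ 2 * h'

/-- The coefficients of the cubic form `u ↦ cub c (u 0 • x + u 1 • y + u 2 • z)`. -/
def cubCoeff {R : Type*} [CommRing R] (c : Fin 10 → R) (x y z : Fin 3 → R) : Fin 10 → R :=
  ![cub c x, cubD c x y, cubD c x z, cubD c y x,
    cubD c (x + y) z - cubD c x z - cubD c y z, cubD c z x, cub c y, cubD c y z, cubD c z y,
    cub c z]

theorem cub_cubCoeff {R : Type*} [CommRing R] (c : Fin 10 → R) (x y z u : Fin 3 → R) :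
    cub (cubCoeff c x y z) u = cub c (u 0 • x + u 1 • y + u 2 • z) := by
  simp only [cub, cubCoeff, cubD, Algebra.algebraMap_self, RingHom.id_apply, Pi.add_apply,
    Pi.smul_apply, smul_eq_mul, Matrix.cons_val]
  ring

/-- Some point of the plane cubic of `c` lies outside the curve of bidegree `(1, q)` of `a`. -/
def ExistsFormNeZero {F : Type*} [Field F] (q : ℕ) (c : Fin 10 → F) (a : Fin 3 → Fin 3 → F) :
    Prop :=
  ∃ y : Fin 3 → F, cub c y = 0 ∧ ∑ i, ∑ j, a i j * y i * y j ^ q ≠ 0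

theorem sum_sum_mul_mul_pow {F : Type*} [Field F] (q : ℕ) (σ : F →+* F) (hσ : ∀ x, σ x = x ^ q)
    (a : Matrix (Fin 3) (Fin 3) F) (y : Fin 3 → F) :
    ∑ i, ∑ j, a i j * y i * y j ^ q = y ⬝ᵥ (a.mulVec (σ ∘ y)) := by
  simp only [dotProduct, Matrix.mulVec, Finset.mul_sum, Function.comp, hσ]
  exact Finset.sum_congr rfl fun i _ => Finset.sum_congr rfl fun j _ => by ring

theorem ExistsFormNeZero.of_cubCoeff {F : Type*} [Field F] [Fintype F] (q : ℕ) (hq : IsPrimePow q)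
    (hF : Fintype.card F = q ^ 2) (c : Fin 10 → F) (x y z : Fin 3 → F)
    (hB : LinearIndependent F ![x, y, z])
    (h : ∀ a : Fin 3 → Fin 3 → F, a ≠ 0 → ExistsFormNeZero q (cubCoeff c x y z) a)
    (a : Fin 3 → Fin 3 → F) (ha : a ≠ 0) : ExistsFormNeZero q c a := by
  obtain ⟨σ, hσ⟩ := exists_frobenius_algebra q hq F hF F
  set B : Matrix (Fin 3) (Fin 3) F := Matrix.of ![x, y, z] with hBdef
  have hu : IsUnit B := Matrix.linearIndependent_rows_iff_isUnit.mp hB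
  have hu' : IsUnit (B.map σ).transpose := by
    rw [Matrix.isUnit_transpose]
    exact hu.map (RingHom.mapMatrix σ)
  have ha' : B * Matrix.of a * (B.map σ).transpose ≠ 0 := by
    rw [Ne, hu'.mul_left_eq_zero, hu.mul_right_eq_zero]
    exact ha
  obtain ⟨u, hu1, hu2⟩ := h _ ha'
  have key : u 0 • x + u 1 • y + u 2 • z = Matrix.vecMul u B := by
    ext j
    simp [Matrix.vecMul, dotProduct, Fin.sum_univ_three, hBdef]
  refine ⟨Matrix.vecMul u B, by rw [← key, ← cub_cubCoeff, hu1], ?_⟩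
  rw [sum_sum_mul_mul_pow q σ hσ] at hu2
  have := sum_sum_mul_mul_pow q σ hσ (Matrix.of a) (Matrix.vecMul u B)
  simp only [Matrix.of_apply] at this
  rw [this]
  convert hu2 using 1
  rw [← Matrix.mulVec_mulVec, ← Matrix.mulVec_mulVec, Matrix.dotProduct_mulVec u,
    Matrix.mulVec_transpose]
  congr 2
  ext j
  simp [Matrix.vecMul, dotProduct]

theorem NoLine.descend {F K : Type*} [Field F] [Field K] [Algebra F K] {c : Fin 10 → F}
    (h : NoLine K c) : NoLine F c := by
  intro u v h1 h2 h3 h4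
  have := h (fun i => algebraMap F K (u i)) (fun i => algebraMap F K (v i))
  have e := map_cub c (Algebra.ofId F K)
  have e' := map_cubD c (Algebra.ofId F K)
  simp only [Algebra.ofId_apply] at e e'
  simp only [← e, ← e', h1, h2, h3, h4, map_zero, Par, ← map_mul,
    (algebraMap F K).injective.eq_iff] at this
  exact this trivial trivial trivial trivial

theorem exists_tangent_vector {F : Type*} [Field F] (c : Fin 10 → F) (O w : Fin 3 → F)
    (hw : cubD c O w ≠ 0) : ∃ x, cubD c O x = 0 ∧ ¬ Par x O := by
  set d : Fin 3 → F := fun i => cubD c O (Pi.single i 1) with hd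
  have hD : ∀ x, cubD c O x = d 0 * x 0 + d 1 * x 1 + d 2 * x 2 := fun x => by
    simp [hd, cubD]
  have hO : O ≠ 0 := by
    rintro rfl
    simp [cubD] at hw
  by_contra! hcon
  have e0 := hcon ![0, d 2, -d 1] (by rw [hD]; simp; ring)
  have e1 := hcon ![-d 2, 0, d 0] (by rw [hD]; simp; ring)
  have e2 := hcon ![d 1, -d 0, 0] (by rw [hD]; simp; ring)
  simp [Par] at e0 e1 e2
  rw [hD] at hw
  obtain ⟨i, hi⟩ := Function.ne_iff.mp hO
  apply hw
  simp only [Pi.zero_apply] at hi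
  have hdd : d 0 = 0 ∧ d 1 = 0 ∧ d 2 = 0 := by
    fin_cases i <;> simp at hi <;> grind
  simp [hdd]

theorem linearIndependent_of_tangent {F : Type*} [Field F] (c : Fin 10 → F) (O x y : Fin 3 → F)
    (hO : cubD c O O = 0) (hx : cubD c O x = 0) (hxO : ¬ Par x O) (hy : cubD c O y ≠ 0) :
    LinearIndependent F ![x, y, O] := by
  rw [Fintype.linearIndependent_iff]
  intro s hs
  simp only [Fin.sum_univ_three, Matrix.cons_val] at hs
  have e := congrArg (cubD c O) hs
  have e' : cubD c O (s 0 • x + s 1 • y + s 2 • O) =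
      s 0 * cubD c O x + s 1 * cubD c O y + s 2 * cubD c O O := by
    simp [cubD]; ring
  rw [e', hx, hO] at e
  have h1 : s 1 = 0 := by
    rw [show cubD c O 0 = 0 by simp [cubD]] at e
    simpa [hy] using e
  rw [h1] at hs
  have g0 := congrFun hs 0
  have g1 := congrFun hs 1
  have g2 := congrFun hs 2
  simp at g0 g1 g2
  have h0 : s 0 = 0 := by
    by_contra h0
    refine hxO ⟨?_, ?_, ?_⟩ <;> apply mul_left_cancel₀ h0
    · linear_combination g0 * O 1 - g1 * O 0
    · linear_combination g0 * O 2 - g2 * O 0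
    · linear_combination g1 * O 2 - g2 * O 1
  have hO' : O ≠ 0 := by
    rintro rfl
    exact hxO (by simp [Par])
  have h2 : s 2 = 0 := by
    rw [h0] at hs
    simpa [hO'] using hs
  intro i
  fin_cases i <;> assumption

theorem existsFormNeZero_of_smooth {F : Type*} [Field F] (q : ℕ) (hq : IsPrimePow q)
    (hq7 : 7 ≤ q) [Fintype F] (hF : Fintype.card F = q ^ 2) (K : Type*) [Field K] [Algebra F K]
    [IsAlgClosed K] (c : Fin 10 → F) (hc : NoLine F c) (O w : Fin 3 → F) (hO : cub c O = 0)
    (hw : cubD c O w ≠ 0) (a : Fin 3 → Fin 3 → F) (ha : a ≠ 0) : ExistsFormNeZero q c a := by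
  have hOO : cubD c O O = 0 := by rw [cubD_self, hO, mul_zero]
  obtain ⟨x, hx, hxO⟩ := exists_tangent_vector c O w hw
  set y := (cubD c O w)⁻¹ • w with hydef
  have hy : cubD c O y = 1 := by rw [hydef, cubD_smul_right, inv_mul_cancel₀ hw]
  by_cases hfl : cubD c x O = 0
  · have hgx : cub c x ≠ 0 := fun h => hxO (hc x O h hO hfl hx)
    exact ExistsFormNeZero.of_cubCoeff q hq hF c x y O
      (linearIndependent_of_tangent c O x y hOO hx hxO (by simp [hy]))
      (fun a ha => exists_form_ne_zero_of_flex q hq hq7 hF K _ hO hx hy hfl hgx a ha) a ha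
  · set x' := (1 : F) • x + (-cub c x / cubD c x O) • O with hx'
    have h1 : cub c x' = 0 := by
      rw [hx', cub_comb, hx, hO]
      field_simp
      ring
    have h2 : cubD c O x' = 0 := by rw [hx', cubD_comb_right, hx, hOO]; ring
    have h3 : cubD c x' O = cubD c x O := by
      have : cubD c x' O = 1 ^ 2 * cubD c x O + 2 * 1 * (-cub c x / cubD c x O) * cubD c O x
          + 3 * (-cub c x / cubD c x O) ^ 2 * cub c O := by
        rw [hx']
        simp [cub, cubD]
        ring
      rw [this, hx, hO]; ring
    have hx'O : ¬ Par x' O := by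
      rintro ⟨g0, g1, g2⟩
      simp [hx'] at g0 g1 g2
      exact hxO ⟨by linear_combination g0, by linear_combination g1, by linear_combination g2⟩
    set y' := (1 : F) • y + (-cubD c x' y / cubD c x' O) • O with hy'
    have h4 : cubD c O y' = 1 := by rw [hy', cubD_comb_right, hy, hOO]; ring
    have h5 : cubD c x' y' = 0 := by
      rw [← h3] at hfl
      rw [hy', cubD_comb_right]
      field_simp
      ring
    exact ExistsFormNeZero.of_cubCoeff q hq hF c x' y' O
      (linearIndependent_of_tangent c O x' y' hOO h2 hx'O (by simp [h4]))
      (fun a ha => exists_form_ne_zero_of_not_flex q hq hq7 hF K _ hO h2 h4 h1 h5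
        (by simpa [cubCoeff, h3] using hfl) a ha) a ha

theorem exists_cub_eq_zero_of_isAlgClosed {F K : Type*} [Field F] [Field K] [Algebra F K]
    [IsAlgClosed K] (c : Fin 10 → F) (u v : Fin 3 → K) :
    ∃ s t : K, (s ≠ 0 ∨ t ≠ 0) ∧ cub c (s • u + t • v) = 0 := by
  by_cases hv : cub c v = 0
  · exact ⟨0, 1, by simp, by rw [cub_comb, hv]; ring⟩
  · obtain ⟨t, ht⟩ := IsAlgClosed.exists_root
      (Polynomial.C (cub c v) * Polynomial.X ^ 3 + Polynomial.C (cubD c v u) * Polynomial.X ^ 2 +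
        Polynomial.C (cubD c u v) * Polynomial.X + Polynomial.C (cub c u))
      (by rw [Polynomial.degree_cubic hv]; decide)
    refine ⟨1, t, by simp, ?_⟩
    simp at ht
    rw [cub_comb]
    linear_combination ht

theorem cubD_eq_zero_of_forall {F K : Type*} [Field F] [Field K] [Algebra F K] (c : Fin 10 → F)
    (O : Fin 3 → F) (h : ∀ w, cubD c w O = 0) (w : Fin 3 → K) :
    cubD c w (fun i => algebraMap F K (O i)) = 0 := by
  have e := fun w => congrArg (algebraMap F K) (h w)
  have h1 := e ![1, 0, 0]
  have h2 := e ![0, 1, 0]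
  have h3 := e ![0, 0, 1]
  have h4 := e ![1, 1, 0]
  have h5 := e ![1, 0, 1]
  have h6 := e ![0, 1, 1]
  simp [cubD, map_ofNat] at h1 h2 h3 h4 h5 h6
  simp only [cubD]
  linear_combination w 0 ^ 2 * h1 + w 1 ^ 2 * h2 + w 2 ^ 2 * h3 + w 0 * w 1 * (h4 - h1 - h2) +
    w 0 * w 2 * (h5 - h1 - h3) + w 1 * w 2 * (h6 - h2 - h3)

theorem cubD_eq_zero_of_forall_right {F K : Type*} [Field F] [Field K] [Algebra F K]
    (c : Fin 10 → F) (O : Fin 3 → F) (h : ∀ w, cubD c O w = 0) (w : Fin 3 → K) :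
    cubD c (fun i => algebraMap F K (O i)) w = 0 := by
  have e := fun w => congrArg (algebraMap F K) (h w)
  have h1 := e ![1, 0, 0]
  have h2 := e ![0, 1, 0]
  have h3 := e ![0, 0, 1]
  simp [cubD, map_ofNat] at h1 h2 h3
  simp only [cubD]
  linear_combination w 0 * h1 + w 1 * h2 + w 2 * h3

theorem NoLine.exists_cubD_ne_zero {F K : Type*} [Field F] [Field K] [Algebra F K]
    [IsAlgClosed K] {c : Fin 10 → F} (hc : NoLine K c) {O : Fin 3 → F} (hO0 : O ≠ 0)
    (hO : cub c O = 0) (hsing : ∀ w, cubD c O w = 0) : ∃ w, cubD c w O ≠ 0 := by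
  by_contra! h
  have hO' : cub c (fun i => algebraMap F K (O i)) = 0 := by
    simpa [hO] using (map_cub c (Algebra.ofId F K) O).symm
  obtain ⟨i, hi⟩ := Function.ne_iff.mp hO0
  simp only [Pi.zero_apply] at hi
  obtain ⟨s, t, hst, h0⟩ := exists_cub_eq_zero_of_isAlgClosed c
    (Pi.single (i + 1) 1 : Fin 3 → K) (Pi.single (i + 2) 1)
  have := hc _ _ hO' h0 (cubD_eq_zero_of_forall_right c O hsing _) (cubD_eq_zero_of_forall c O h _)
  fin_cases i <;> simp [Par] at hi this <;> grind

theorem NoLine.exists_smooth {F K : Type*} [Field F] [Field K] [Algebra F K]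
    [IsAlgClosed K] {c : Fin 10 → F} (hc : NoLine K c) {O : Fin 3 → F} (hO0 : O ≠ 0)
    (hO : cub c O = 0) : ∃ x w : Fin 3 → F, cub c x = 0 ∧ cubD c x w ≠ 0 := by
  by_contra! h
  obtain ⟨w, hw⟩ := hc.exists_cubD_ne_zero hO0 hO (fun w => h O w hO)
  have h1 := h O w hO
  have h2 : cub c ((-cub c w) • O + cubD c w O • w) = 0 := by
    rw [cub_comb, hO, h1]
    ring
  have h3 := h _ O h2
  rw [cubD_comb_self, hO, h1] at h3
  exact hw (by simpa using h3)

theorem existsFormNeZero_of_zero {F : Type*} [Field F] (q : ℕ) (hq : IsPrimePow q)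
    (hq7 : 7 ≤ q) [Fintype F] (hF : Fintype.card F = q ^ 2) (K : Type*) [Field K] [Algebra F K]
    [IsAlgClosed K] (c : Fin 10 → F) (hc : NoLine K c) (O : Fin 3 → F) (hO0 : O ≠ 0)
    (hO : cub c O = 0) (a : Fin 3 → Fin 3 → F) (ha : a ≠ 0) : ExistsFormNeZero q c a := by
  obtain ⟨x, w, hx, hw⟩ := hc.exists_smooth hO0 hO
  exact existsFormNeZero_of_smooth q hq hq7 hF K c hc.descend x w hx hw a ha

theorem MvPolynomial.exists_ne_zero_eval_eq_zero {K : Type*} [Field K] [IsAlgClosed K]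
    (f g : MvPolynomial (Fin 3) K) (hf : eval 0 f = 0) (hg : eval 0 g = 0) :
    ∃ P : Fin 3 → K, P ≠ 0 ∧ eval P f = 0 ∧ eval P g = 0 := by
  classical
  by_contra! hcon
  set φ₁ : MvPolynomial (Fin 3) K →ₐ[K] MvPolynomial (Fin 3) K := aeval ![0, X 1, X 2]
  set φ₂ : MvPolynomial (Fin 3) K →ₐ[K] MvPolynomial (Fin 3) K := aeval ![0, 0, X 2]
  set φ₃ : MvPolynomial (Fin 3) K →ₐ[K] K := aeval 0
  have h12 : φ₂ = φ₂.comp φ₁ := by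
    ext i
    fin_cases i <;> simp [φ₁, φ₂]
  have h23 : φ₃ = φ₃.comp φ₂ := by
    ext i
    fin_cases i <;> simp [φ₂, φ₃]
  have i₁ : (RingHom.ker φ₁).IsPrime := RingHom.ker_isPrime _
  have i₂ : (RingHom.ker φ₂).IsPrime := RingHom.ker_isPrime _
  have i₃ : (RingHom.ker φ₃).IsPrime := RingHom.ker_isPrime _
  have l₁ : ⊥ < RingHom.ker φ₁ := by
    rw [bot_lt_iff_ne_bot]
    intro h
    have : (X 0 : MvPolynomial (Fin 3) K) ∈ RingHom.ker φ₁ := by simp [φ₁]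
    simp [h] at this
  have l₂ : RingHom.ker φ₁ < RingHom.ker φ₂ := by
    refine lt_of_le_of_ne (fun x hx => ?_) fun h => ?_
    · rw [RingHom.mem_ker] at hx ⊢
      rw [h12, AlgHom.comp_apply, hx, map_zero]
    · have : (X 1 : MvPolynomial (Fin 3) K) ∈ RingHom.ker φ₂ := by simp [φ₂]
      rw [← h] at this
      simp [φ₁] at this
  have l₃ : RingHom.ker φ₂ < RingHom.ker φ₃ := by
    refine lt_of_le_of_ne (fun x hx => ?_) fun h => ?_
    · rw [RingHom.mem_ker] at hx ⊢
      rw [h23, AlgHom.comp_apply, hx, map_zero]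
    · have : (X 2 : MvPolynomial (Fin 3) K) ∈ RingHom.ker φ₃ := by simp [φ₃]
      rw [← h] at this
      simp [φ₂] at this
  have hmem : ∀ p, p ∈ RingHom.ker φ₃ ↔ eval 0 p = 0 := fun p => by
    rw [RingHom.mem_ker, ← aeval_eq_eval]
  have hmin : RingHom.ker φ₃ ∈ (Ideal.span (({f, g} : Finset (MvPolynomial (Fin 3) K)) :
      Set (MvPolynomial (Fin 3) K))).minimalPrimes := by
    refine ⟨⟨i₃, ?_⟩, fun J hJ _ p hp => ?_⟩
    · rw [Ideal.span_le]
      intro p hp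
      simp only [Finset.coe_insert, Finset.coe_singleton, Set.mem_insert_iff,
        Set.mem_singleton_iff] at hp
      rcases hp with rfl | rfl
      · exact (hmem _).mpr hf
      · exact (hmem _).mpr hg
    · rw [← hJ.1.radical, ← vanishingIdeal_zeroLocus_eq_radical (K := K), mem_vanishingIdeal_iff]
      intro P hP
      have hP0 : P = 0 := by
        by_contra hP0
        rw [mem_zeroLocus_iff] at hP
        have hsub := Ideal.span_le.mp hJ.2
        have e1 := hP f (hsub (by simp))
        have e2 := hP g (hsub (by simp))
        rw [aeval_eq_eval] at e1 e2
        exact hcon P hP0 e1 e2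
      rw [hP0]
      exact (RingHom.mem_ker).mp hp
  have h3 := Ideal.height_le_card_of_mem_minimalPrimes_span_finset hmin
  have c1 := Ideal.height_add_one_le_of_lt_of_isPrime l₁
  have c2 := Ideal.height_add_one_le_of_lt_of_isPrime l₂
  have c3 := Ideal.height_add_one_le_of_lt_of_isPrime l₃
  have h4 : ((Finset.card {f, g} : ℕ) : ℕ∞) ≤ 2 := by exact_mod_cast Finset.card_le_two
  have : (3 : ℕ∞) ≤ 2 := calc
    (3 : ℕ∞) = 0 + 1 + 1 + 1 := by norm_num
    _ ≤ (⊥ : Ideal (MvPolynomial (Fin 3) K)).height + 1 + 1 + 1 := by gcongr; simp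
    _ ≤ (RingHom.ker φ₁).height + 1 + 1 := by gcongr
    _ ≤ (RingHom.ker φ₂).height + 1 := by gcongr
    _ ≤ _ := c3
    _ ≤ _ := h3
    _ ≤ 2 := h4
  exact absurd this (by decide)

section
variable {F K : Type*} [Field F] [Fintype F] [Field K] [Algebra F K]

theorem cub_pow_card {S : Type*} [CommRing S] [Algebra F S] (c : Fin 10 → F) (u : Fin 3 → S) :
    cub c (u ^ Fintype.card F) = cub c u ^ Fintype.card F :=
  (map_cub c (FiniteField.frobeniusAlgHom F S) u).symm

theorem cubD_pow_card {S : Type*} [CommRing S] [Algebra F S] (c : Fin 10 → F) (u v : Fin 3 → S) :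
    cubD c (u ^ Fintype.card F) (v ^ Fintype.card F) = cubD c u v ^ Fintype.card F :=
  (map_cubD c (FiniteField.frobeniusAlgHom F S) u v).symm

theorem not_par_pow_card {c : Fin 10 → F} (hn : ∀ O : Fin 3 → F, cub c O = 0 → O = 0)
    {P : Fin 3 → K} (hP0 : P ≠ 0) (hP : cub c P = 0) : ¬ Par (P ^ Fintype.card F) P := by
  intro h
  obtain ⟨k, hk⟩ := h.exists_smul hP0
  obtain ⟨i, hi⟩ := Function.ne_iff.mp hP0
  simp only [Pi.zero_apply] at hi
  have hk' : ∀ j, P j ^ Fintype.card F = k * P j := fun j => congrFun hk j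
  have hk0 : k ≠ 0 := by
    rintro rfl
    exact hi (by simpa using hk' i)
  have : ∀ j, ∃ a : F, algebraMap F K a = (P i)⁻¹ * P j := fun j => by
    apply exists_algebraMap_eq_of_pow_card
    rw [mul_pow, inv_pow, hk', hk']
    field_simp
  choose O hO using this
  have e : (fun j => algebraMap F K (O j)) = (P i)⁻¹ • P := funext hO
  have e1 := map_cub c (Algebra.ofId F K) O
  simp only [Algebra.ofId_apply, e, cub_smul, hP, mul_zero] at e1
  have e2 := hn O ((map_eq_zero _).mp e1)
  have e3 := hO i
  rw [e2, inv_mul_cancel₀ hi] at e3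
  simp at e3

theorem Par.symm {S : Type*} [CommRing S] {u v : Fin 3 → S} (h : Par u v) : Par v u :=
  ⟨by linear_combination -h.1, by linear_combination -h.2.1, by linear_combination -h.2.2⟩

theorem not_par_pow_card_pow_card {c : Fin 10 → F} (hc : NoLine K c)
    (hn : ∀ O : Fin 3 → F, cub c O = 0 → O = 0) {P : Fin 3 → K} (hP0 : P ≠ 0)
    (hP : cub c P = 0) : ¬ Par ((P ^ Fintype.card F) ^ Fintype.card F) P := by
  intro h
  obtain ⟨k, hk⟩ := h.exists_smul hP0
  have hpar := not_par_pow_card hn hP0 hP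
  set n := Fintype.card F
  have hn0 : n ≠ 0 := Fintype.card_ne_zero
  have hP' : cub c (P ^ n) = 0 := by rw [cub_pow_card, hP, zero_pow hn0]
  have hα : cubD c P (P ^ n) ^ n = k * cubD c (P ^ n) P := by
    rw [← cubD_pow_card, hk, cubD_smul_right]
  have hβ : cubD c (P ^ n) P ^ n = k ^ 2 * cubD c P (P ^ n) := by
    rw [← cubD_pow_card, hk, cubD_smul_left]
  set α := cubD c P (P ^ n)
  set β := cubD c (P ^ n) P
  set v : Fin 3 → K := β • P + (-α) • P ^ n with hv
  have hv0 : cub c v = 0 := by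
    rw [hv, cub_comb, hP, hP']
    ring
  have hvn : v ^ n = (-k ^ 2) • v := by
    have e := fun j => map_sub (FiniteField.frobeniusAlgHom F K) (β * P j) (α * P j ^ n)
    simp only [FiniteField.coe_frobeniusAlgHom] at e
    ext j
    have hkj : (P j ^ n) ^ n = k * P j := congrFun hk j
    simp only [hv, Pi.pow_apply, Pi.add_apply, Pi.smul_apply, smul_eq_mul, neg_mul,
      ← sub_eq_add_neg]
    rw [e, mul_pow, mul_pow, hα, hβ, hkj]
    ring
  by_cases hvz : v = 0
  · by_cases hα0 : α = 0
    · by_cases hβ0 : β = 0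
      · exact hpar (hc _ _ hP hP' hα0 hβ0).symm
      · rw [hv, hα0] at hvz
        exact hP0 (by simpa [hβ0] using hvz)
    · apply hpar
      have : P ^ n = (α⁻¹ * β) • P := by
        ext j
        have := congrFun hvz j
        simp [hv] at this ⊢
        field_simp
        linear_combination -this
      rw [this]
      exact Par.smul_left _ _
  · exact not_par_pow_card hn hvz hv0 (hvn ▸ Par.smul_left _ _)

end

section
variable {F K : Type*} [Field F] [Field K] [Algebra F K]

theorem exists_polynomial_quadratic {S : Type*} [CommRing S] [Algebra F S] {c : Fin 10 → F}
    {u v : Fin 3 → F} (hv : cub c v ≠ 0) {x : Fin 3 → S} (hcx : cub c x = 0)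
    (hx : x = x 2 • (algebraMap F S ∘ u) + x 1 • (algebraMap F S ∘ v))
    (f : MvPolynomial (Fin 3) F) :
    ∃ r₀ r₁ r₂ : Polynomial F, aeval x f = Polynomial.aeval (x 2) r₀ +
      Polynomial.aeval (x 2) r₁ * x 1 + Polynomial.aeval (x 2) r₂ * x 1 ^ 2 := by
  have hcub : algebraMap F S (cub c v) * x 1 ^ 3 = -(x 2 ^ 3 * algebraMap F S (cub c u) +
      x 2 ^ 2 * x 1 * algebraMap F S (cubD c u v) +
      x 2 * x 1 ^ 2 * algebraMap F S (cubD c v u)) := by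
    have e := fun w => map_cub c (Algebra.ofId F S) w
    have e' := fun w z => map_cubD c (Algebra.ofId F S) w z
    simp only [Algebra.ofId_apply] at e e'
    rw [hx, cub_comb] at hcx
    simp only [Function.comp_def] at hcx
    rw [e, e, e', e']
    linear_combination hcx
  set k := (cub c v)⁻¹ with hk
  have hcub' : x 1 ^ 3 = -algebraMap F S k * (x 2 ^ 3 * algebraMap F S (cub c u) +
      x 2 ^ 2 * x 1 * algebraMap F S (cubD c u v) +
      x 2 * x 1 ^ 2 * algebraMap F S (cubD c v u)) := by
    have : algebraMap F S k * algebraMap F S (cub c v) = 1 := by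
      rw [← map_mul, hk, inv_mul_cancel₀ hv, map_one]
    linear_combination algebraMap F S k * hcub - this * x 1 ^ 3
  have h1 : ∀ r₀ r₁ r₂ : Polynomial F, ∃ s₀ s₁ s₂ : Polynomial F,
      (Polynomial.aeval (x 2) r₀ + Polynomial.aeval (x 2) r₁ * x 1 +
        Polynomial.aeval (x 2) r₂ * x 1 ^ 2) * x 1 = Polynomial.aeval (x 2) s₀ +
      Polynomial.aeval (x 2) s₁ * x 1 + Polynomial.aeval (x 2) s₂ * x 1 ^ 2 := by
    intro r₀ r₁ r₂
    refine ⟨r₂ * (Polynomial.C (-k * cub c u) * Polynomial.X ^ 3),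
      r₀ + r₂ * (Polynomial.C (-k * cubD c u v) * Polynomial.X ^ 2),
      r₁ + r₂ * (Polynomial.C (-k * cubD c v u) * Polynomial.X), ?_⟩
    simp only [map_add, map_mul, map_pow, Polynomial.aeval_C, Polynomial.aeval_X, map_neg]
    linear_combination Polynomial.aeval (x 2) r₂ * hcub'
  induction f using MvPolynomial.induction_on with
  | C a => exact ⟨Polynomial.C a, 0, 0, by simp⟩
  | add f g hf hg =>
    obtain ⟨r₀, r₁, r₂, hr⟩ := hf
    obtain ⟨s₀, s₁, s₂, hs⟩ := hg
    exact ⟨r₀ + s₀, r₁ + s₁, r₂ + s₂, by simp only [map_add, hr, hs]; ring⟩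
  | mul_X f i hf =>
    obtain ⟨r₀, r₁, r₂, hr⟩ := hf
    obtain ⟨s₀, s₁, s₂, hs⟩ := h1 r₀ r₁ r₂
    rw [map_mul, aeval_X, hr]
    have h2 : x i = x 2 * algebraMap F S (u i) + x 1 * algebraMap F S (v i) := congrFun hx i
    refine ⟨r₀ * (Polynomial.C (u i) * Polynomial.X) + Polynomial.C (v i) * s₀,
      r₁ * (Polynomial.C (u i) * Polynomial.X) + Polynomial.C (v i) * s₁,
      r₂ * (Polynomial.C (u i) * Polynomial.X) + Polynomial.C (v i) * s₂, ?_⟩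
    rw [h2]
    simp only [map_add, map_mul, Polynomial.aeval_C, Polynomial.aeval_X]
    linear_combination algebraMap F S (v i) * hs

theorem aeval_mul_C_eq_zero {θ : K}
    (hθ : ∀ a b d : F, algebraMap F K a + algebraMap F K b * θ + algebraMap F K d * θ ^ 2 = 0 →
      a = 0 ∧ b = 0 ∧ d = 0) {r₀ r₁ r₂ : Polynomial F}
    (h : Polynomial.aeval (Polynomial.X : Polynomial K) r₀ +
      Polynomial.aeval (Polynomial.X : Polynomial K) r₁ * (Polynomial.C θ * Polynomial.X) +
      Polynomial.aeval (Polynomial.X : Polynomial K) r₂ * (Polynomial.C θ * Polynomial.X) ^ 2 = 0) :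
    r₀ = 0 ∧ r₁ = 0 ∧ r₂ = 0 := by
  have e : ∀ r : Polynomial F, Polynomial.aeval (Polynomial.X : Polynomial K) r =
      r.map (algebraMap F K) := fun r => Polynomial.aeval_X_left_eq_map r
  have key : ∀ n, r₀.coeff n = 0 ∧ (r₁ * Polynomial.X).coeff n = 0 ∧
      (r₂ * Polynomial.X ^ 2).coeff n = 0 := fun n => by
    apply hθ
    have h' : r₀.map (algebraMap F K) + (r₁ * Polynomial.X).map (algebraMap F K) * Polynomial.C θ +
        (r₂ * Polynomial.X ^ 2).map (algebraMap F K) * Polynomial.C (θ ^ 2) = 0 := by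
      simp only [Polynomial.map_mul, Polynomial.map_pow, Polynomial.map_X, Polynomial.C_pow]
      rw [e, e, e] at h
      linear_combination h
    have := congrArg (fun p => Polynomial.coeff p n) h'
    simpa only [Polynomial.coeff_add, Polynomial.coeff_mul_C, Polynomial.coeff_map,
      Polynomial.coeff_zero] using this
  refine ⟨Polynomial.ext fun n => (key n).1, ?_, ?_⟩
  · have : r₁ * Polynomial.X = 0 := Polynomial.ext fun n => (key n).2.1
    simpa using this
  · have : r₂ * Polynomial.X ^ 2 = 0 := Polynomial.ext fun n => (key n).2.2
    simpa using this

/-- If `ε` specialises the generic point `x` of a cubic to a multiple of a point of degree three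
on the line through `u` and `v`, its kernel is generated by the equation `l` of that line. -/
theorem dvd_of_map_eq_zero {R : Type*} [CommRing R] [Algebra F R] {c : Fin 10 → F}
    {u v : Fin 3 → F} (hv : cub c v ≠ 0) {x : Fin 3 → R} (hcx : cub c x = 0)
    (hgen : ∀ r : R, ∃ f : MvPolynomial (Fin 3) F, aeval x f = r) (l : R)
    (hl : ∀ i, l ∣ x i - (x 2 * algebraMap F R (u i) + x 1 * algebraMap F R (v i)))
    (ε : R →ₐ[F] Polynomial K) (hε : ε l = 0) {θ : K}
    (hθ : ∀ a b d : F, algebraMap F K a + algebraMap F K b * θ + algebraMap F K d * θ ^ 2 = 0 →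
      a = 0 ∧ b = 0 ∧ d = 0)
    (h1 : ε (x 1) = Polynomial.C θ * Polynomial.X) (h2 : ε (x 2) = Polynomial.X)
    (r : R) (hr : ε r = 0) : l ∣ r := by
  obtain ⟨f, rfl⟩ := hgen r
  set π := Ideal.Quotient.mkₐ F (Ideal.span {l}) with hπ
  have hπ0 : ∀ s, π s = 0 ↔ l ∣ s := fun s => by
    rw [hπ, Ideal.Quotient.mkₐ_eq_mk, Ideal.Quotient.eq_zero_iff_mem, Ideal.mem_span_singleton]
  obtain ⟨r₀, r₁, r₂, hrr⟩ := exists_polynomial_quadratic hv (x := fun i => π (x i))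
    (by rw [← map_cub, hcx, map_zero])
    (by
      ext i
      have := (hπ0 _).mpr (hl i)
      simp only [map_sub, map_add, map_mul, AlgHom.commutes] at this
      simpa using sub_eq_zero.mp this) f
  set s : R := Polynomial.aeval (x 2) r₀ + Polynomial.aeval (x 2) r₁ * x 1 +
    Polynomial.aeval (x 2) r₂ * x 1 ^ 2 with hs
  have hπs : π (aeval x f - s) = 0 := by
    rw [map_sub, sub_eq_zero, hs]
    simp only [map_add, map_mul, map_pow, ← Polynomial.aeval_algHom_apply, ← hrr]
    exact comp_aeval_apply x π f
  have hdvd := (hπ0 _).mp hπs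
  have hεs : ε s = 0 := by
    obtain ⟨m, hm⟩ := hdvd
    have := congrArg ε hm
    rw [map_sub, hr, map_mul, hε] at this
    simpa using this
  rw [hs] at hεs
  simp only [map_add, map_mul, map_pow, ← Polynomial.aeval_algHom_apply, h1, h2] at hεs
  obtain ⟨rfl, rfl, rfl⟩ := aeval_mul_C_eq_zero hθ hεs
  simpa [hs] using hdvd
end

theorem sq_dvd_cubD {F R : Type*} [CommRing F] [CommRing R] [IsDomain R] [Algebra F R]
    (c : Fin 10 → F) {r z : Fin 3 → R} (hr : cub c r = 0) (hz : cub c z = 0) {l : R}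
    (hl : Prime l) (hz2 : ¬ l ∣ z 2) (hw : ∀ i, l ∣ z 2 * r i - r 2 * z i) :
    l ^ 2 ∣ cubD c r z := by
  choose η hη using hw
  have hrz : z 2 • r = r 2 • z + l • η := by
    ext i
    simp only [Pi.smul_apply, Pi.add_apply, smul_eq_mul]
    linear_combination hη i
  have h1 := cub_smul c r (z 2)
  rw [hrz, cub_comb, hr, hz] at h1
  have h2 : l ∣ r 2 * cubD c z η := by
    have : l * (r 2 ^ 2 * cubD c z η + l * (r 2 * cubD c η z + l * cub c η)) = l * 0 := by
      linear_combination h1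
    have h3 : l ∣ r 2 ^ 2 * cubD c z η :=
      ⟨-(r 2 * cubD c η z + l * cub c η), by linear_combination mul_left_cancel₀ hl.ne_zero this⟩
    rcases hl.dvd_or_dvd h3 with h | h
    · exact (hl.dvd_of_dvd_pow h).mul_right _
    · exact h.mul_left _
  obtain ⟨m, hm⟩ := h2
  have h4 := cubD_smul_left c r z (z 2)
  rw [hrz, add_comm, add_comm] at h4
  refine hl.pow_dvd_of_dvd_mul_left 2 (a := z 2 ^ 2) (fun h => hz2 (hl.dvd_of_dvd_pow h)) ?_
  refine ⟨2 * m + cubD c η z, ?_⟩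
  rw [← h4]
  have : cubD c (r 2 • z + l • η) z =
      3 * r 2 ^ 2 * cub c z + 2 * r 2 * l * cubD c z η + l ^ 2 * cubD c η z := by
    simp [cub, cubD]
    ring
  rw [this, hz]
  linear_combination 2 * l * hm

section
variable {F S T : Type*} [Field F] [Fintype F] [CommRing S] [Algebra F S] [CommRing T] [Algebra F T]
  (c : Fin 10 → F)

/-- The third intersection point of the cubic curve of `c` with the line joining its point `P` to
the image of `P` under the Frobenius map. -/
def thirdPoint (P : Fin 3 → S) : Fin 3 → S :=
  cubD c (P ^ Fintype.card F) P • P - cubD c P (P ^ Fintype.card F) • P ^ Fintype.card F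

variable {c}

theorem cub_thirdPoint {P : Fin 3 → S} (hP : cub c P = 0) : cub c (thirdPoint c P) = 0 := by
  rw [thirdPoint, sub_eq_add_neg, ← neg_smul, cub_comb, cub_pow_card, hP,
    zero_pow Fintype.card_ne_zero]
  ring

theorem map_thirdPoint (f : S →ₐ[F] T) (P : Fin 3 → S) (i : Fin 3) :
    f (thirdPoint c P i) = thirdPoint c (fun i => f (P i)) i := by
  have : (fun i => f ((P ^ Fintype.card F) i)) = (fun i => f (P i)) ^ Fintype.card F := by
    ext i
    simp
  simp only [thirdPoint, Pi.sub_apply, Pi.smul_apply, smul_eq_mul, map_sub, map_mul, map_cubD, this]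
  simp

theorem map_cubD_thirdPoint (f : S →ₐ[F] T) (P : Fin 3 → S) :
    f (cubD c (thirdPoint c P) ((P ^ Fintype.card F) ^ Fintype.card F)) =
      cubD c (thirdPoint c fun i => f (P i))
        (((fun i => f (P i)) ^ Fintype.card F) ^ Fintype.card F) := by
  rw [map_cubD, funext (map_thirdPoint f P)]
  congr 1
  ext i
  simp

theorem thirdPoint_smul (P : Fin 3 → S) (s : S) :
    thirdPoint c (s • P) = s ^ (2 * Fintype.card F + 2) • thirdPoint c P := by
  simp only [thirdPoint, smul_pow, cubD_smul_left, cubD_smul_right]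
  ext i
  simp only [Pi.sub_apply, Pi.smul_apply, smul_eq_mul, Pi.pow_apply]
  ring

theorem cubD_thirdPoint_smul (P : Fin 3 → S) (s : S) :
    cubD c (thirdPoint c (s • P)) (((s • P) ^ Fintype.card F) ^ Fintype.card F) =
      s ^ (2 * (2 * Fintype.card F + 2) + Fintype.card F * Fintype.card F) *
        cubD c (thirdPoint c P) ((P ^ Fintype.card F) ^ Fintype.card F) := by
  rw [thirdPoint_smul, smul_pow, smul_pow, cubD_smul_left, cubD_smul_right]
  ring

end

section
variable {F K : Type*} [Field F] [Fintype F] [Field K] [Algebra F K]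

theorem exists_cubic_point_on_line [IsAlgClosed K] {c : Fin 10 → F} (hc : NoLine K c)
    (hn : ∀ O : Fin 3 → F, cub c O = 0 → O = 0) (b d : F) :
    ∃ P : Fin 3 → K, P 0 = -(algebraMap F K b * P 1 + algebraMap F K d) ∧ P 2 = 1 ∧ cub c P = 0 ∧
      (∀ k₀ k₁ k₂ : F, algebraMap F K k₀ + algebraMap F K k₁ * P 1 + algebraMap F K k₂ * P 1 ^ 2 = 0
        → k₀ = 0 ∧ k₁ = 0 ∧ k₂ = 0) ∧
      Par (thirdPoint c P) ((P ^ Fintype.card F) ^ Fintype.card F) := by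
  obtain ⟨s, t, hst, h0⟩ := exists_cub_eq_zero_of_isAlgClosed c
    (![-algebraMap F K d, 0, 1] : Fin 3 → K) ![-algebraMap F K b, 1, 0]
  have hs : s ≠ 0 := by
    rintro rfl
    have ht : t ≠ 0 := by simpa using hst
    rw [zero_smul, zero_add, cub_smul] at h0
    have h1 : algebraMap F K (cub c ![-b, 1, 0]) = 0 := by
      have := map_cub c (Algebra.ofId F K) ![-b, 1, 0]
      simp only [Algebra.ofId_apply] at this
      rw [this]
      convert (mul_eq_zero.mp h0).resolve_left (pow_ne_zero 3 ht) using 2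
      ext i
      fin_cases i <;> simp
    have := congrFun (hn _ ((map_eq_zero _).mp h1)) 1
    simp at this
  set θ := t / s with hθ
  set P : Fin 3 → K := ![-(algebraMap F K b * θ + algebraMap F K d), θ, 1] with hPdef
  have hP : cub c P = 0 := by
    have : s⁻¹ • (s • (![-algebraMap F K d, 0, 1] : Fin 3 → K) + t • ![-algebraMap F K b, 1, 0])
        = P := by
      ext i
      fin_cases i <;> simp [hPdef, hθ] <;> field_simp
    rw [← this, cub_smul, h0, mul_zero]
  have hP0 : P ≠ 0 := fun h => by simpa [hPdef] using congrFun h 2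
  set φ := FiniteField.frobeniusAlgHom F K with hφ
  have hφx : ∀ x : K, x ^ Fintype.card F = φ x := fun x => by
    rw [hφ, FiniteField.coe_frobeniusAlgHom]
  have hP1 : P ^ Fintype.card F =
      ![-(algebraMap F K b * φ θ + algebraMap F K d), φ θ, 1] := by
    ext i
    rw [Pi.pow_apply, hφx]
    fin_cases i <;> simp [hPdef, AlgHom.commutes]
  have hP2 : (P ^ Fintype.card F) ^ Fintype.card F =
      ![-(algebraMap F K b * φ (φ θ) + algebraMap F K d), φ (φ θ), 1] := by
    ext i
    rw [hP1, Pi.pow_apply, hφx]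
    fin_cases i <;> simp [AlgHom.commutes]
  have n1 : φ θ - θ ≠ 0 := fun h => not_par_pow_card hn hP0 hP (by
    rw [hP1, sub_eq_zero.mp h]
    simp [Par, hPdef, mul_comm])
  have n2 : φ (φ θ) - φ θ ≠ 0 := fun h => n1 (by
    rw [← map_sub] at h
    exact (map_eq_zero φ).mp h)
  have n3 : φ (φ θ) - θ ≠ 0 := fun h => not_par_pow_card_pow_card hc hn hP0 hP (by
    rw [hP2, sub_eq_zero.mp h]
    simp [Par, hPdef, mul_comm])
  have hcP1 : cub c (P ^ Fintype.card F) = 0 := by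
    rw [cub_pow_card, hP, zero_pow Fintype.card_ne_zero]
  have hcP2 : cub c ((P ^ Fintype.card F) ^ Fintype.card F) = 0 := by
    rw [cub_pow_card, hcP1, zero_pow Fintype.card_ne_zero]
  refine ⟨P, by simp [hPdef], by simp [hPdef], hP, fun k₀ k₁ k₂ hk => ?_, ?_⟩
  · have e0 : algebraMap F K k₀ + algebraMap F K k₁ * θ + algebraMap F K k₂ * θ ^ 2 = 0 := hk
    have e1 := congrArg φ e0
    have e2 := congrArg φ e1
    simp only [map_add, map_mul, map_pow, AlgHom.commutes, map_zero] at e1 e2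
    have f1 : algebraMap F K k₁ + algebraMap F K k₂ * (θ + φ θ) = 0 :=
      mul_left_cancel₀ n1 (by linear_combination e1 - e0)
    have f2 : algebraMap F K k₁ + algebraMap F K k₂ * (φ θ + φ (φ θ)) = 0 :=
      mul_left_cancel₀ n2 (by linear_combination e2 - e1)
    have g2 : algebraMap F K k₂ = 0 := mul_left_cancel₀ n3 (by linear_combination f2 - f1)
    have g1 : algebraMap F K k₁ = 0 := by linear_combination f1 - g2 * (θ + φ θ)
    have g0 : algebraMap F K k₀ = 0 := by linear_combination e0 - g1 * θ - g2 * θ ^ 2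
    simpa using And.intro g0 (And.intro g1 g2)
  · have hcomb : (φ θ - θ) • (P ^ Fintype.card F) ^ Fintype.card F =
        (φ θ - φ (φ θ)) • P + (φ (φ θ) - θ) • P ^ Fintype.card F := by
      rw [hP1] at hP2 ⊢
      rw [hP2]
      ext i
      fin_cases i <;> simp [hPdef] <;> ring
    have hz := cub_smul c ((P ^ Fintype.card F) ^ Fintype.card F) (φ θ - θ)
    rw [hcomb, cub_comb, hP, hcP1, hcP2] at hz
    have hn2 : φ θ - φ (φ θ) ≠ 0 := by rwa [← neg_sub, neg_ne_zero] at n2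
    have hz' : (φ θ - φ (φ θ)) * cubD c P (P ^ Fintype.card F) +
        (φ (φ θ) - θ) * cubD c (P ^ Fintype.card F) P = 0 :=
      mul_left_cancel₀ (mul_ne_zero hn2 n3) (by linear_combination hz)
    have hj := fun i => congrFun hcomb i
    simp only [Pi.smul_apply, Pi.add_apply, smul_eq_mul] at hj
    simp only [thirdPoint]
    set P' := P ^ Fintype.card F
    refine ⟨?_, ?_, ?_⟩ <;> apply mul_left_cancel₀ n1 <;>
      simp only [Pi.smul_apply, Pi.sub_apply, smul_eq_mul]
    · linear_combination (cubD c P' P * P 0 - cubD c P P' * P' 0) * hj 1 -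
        (cubD c P' P * P 1 - cubD c P P' * P' 1) * hj 0 + (P 0 * P' 1 - P 1 * P' 0) * hz'
    · linear_combination (cubD c P' P * P 0 - cubD c P P' * P' 0) * hj 2 -
        (cubD c P' P * P 2 - cubD c P P' * P' 2) * hj 0 + (P 0 * P' 2 - P 2 * P' 0) * hz'
    · linear_combination (cubD c P' P * P 1 - cubD c P P' * P' 1) * hj 2 -
        (cubD c P' P * P 2 - cubD c P P' * P' 2) * hj 1 + (P 1 * P' 2 - P 2 * P' 1) * hz'
end

theorem prod_pow_dvd {R ι : Type*} [CommRing R] [IsDomain R] (s : Finset ι) (p : ι → R) (n : ℕ)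
    (hp : ∀ i, Prime (p i)) (hpp : ∀ i j, p i ∣ p j → i = j) {z : R} (hz : ∀ i, p i ^ n ∣ z) :
    ∏ i ∈ s, p i ^ n ∣ z := by
  classical
  induction s using Finset.induction_on with
  | empty => simp
  | insert i s hi ih =>
    obtain ⟨m, hm⟩ := ih
    have h : ¬ p i ∣ ∏ j ∈ s, p j ^ n := fun h => by
      obtain ⟨j, hj, hij⟩ := (hp i).exists_mem_finset_dvd h
      exact hi (hpp i j ((hp i).dvd_of_dvd_pow hij) ▸ hj)
    obtain ⟨m', hm'⟩ := (hp i).pow_dvd_of_dvd_mul_left n h (hm ▸ hz i)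
    exact ⟨m', by rw [Finset.prod_insert hi, hm, hm']; ring⟩

theorem map_line {F K R : Type*} [Field F] [Field K] [Algebra F K] [CommRing R]
    [Algebra F R] {x : Fin 3 → R} (ε : R →ₐ[F] Polynomial K) {P : Fin 3 → K}
    (hε : ∀ i, ε (x i) = Polynomial.C (P i) * Polynomial.X)
    (b d : F) : ε (x 0 + algebraMap F R b * x 1 + algebraMap F R d * x 2) =
      Polynomial.C (P 0 + algebraMap F K b * P 1 + algebraMap F K d * P 2) * Polynomial.X := by
  simp only [map_add, map_mul, AlgHom.commutes, hε, Polynomial.algebraMap_apply]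
  ring

section
variable {F K : Type*} [Field F] [Fintype F] [Field K] [Algebra F K]

theorem sq_line_dvd_cubD_thirdPoint [IsAlgClosed K] {R : Type*} [CommRing R] [IsDomain R]
    [Algebra F R] {c : Fin 10 → F}
    (hc : NoLine K c) (hn : ∀ O : Fin 3 → F, cub c O = 0 → O = 0) {x : Fin 3 → R}
    (hcx : cub c x = 0) (hgen : ∀ r : R, ∃ f : MvPolynomial (Fin 3) F, aeval x f = r)
    (hlift : ∀ P : Fin 3 → K, cub c P = 0 →
      ∃ ε : R →ₐ[F] Polynomial K, ∀ i, ε (x i) = Polynomial.C (P i) * Polynomial.X) :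
    (∏ i : F × F, (x 0 + algebraMap F R i.1 * x 1 + algebraMap F R i.2 * x 2) ^ 2) ∣
      cubD c (thirdPoint c x) ((x ^ Fintype.card F) ^ Fintype.card F) := by
  set z := (x ^ Fintype.card F) ^ Fintype.card F with hz
  have hcz : cub c z = 0 := by
    rw [hz, cub_pow_card, cub_pow_card, hcx, zero_pow Fintype.card_ne_zero,
      zero_pow Fintype.card_ne_zero]
  choose P hP0 hP2 hcP hPli hPpar using
    fun i : F × F => exists_cubic_point_on_line (K := K) hc hn i.1 i.2
  choose ε hε using fun i => hlift (P i) (hcP i)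
  set l : F × F → R := fun i => x 0 + algebraMap F R i.1 * x 1 + algebraMap F R i.2 * x 2 with hl
  have hεl : ∀ i j, ε i (l j) = 0 → i = j := fun i j h => by
    rw [hl, map_line (ε i) (hε i), hP0, hP2, mul_eq_zero, Polynomial.C_eq_zero] at h
    have := h.resolve_right Polynomial.X_ne_zero
    obtain ⟨h0, h1, -⟩ := hPli i (j.2 - i.2) (j.1 - i.1) 0 (by
      rw [map_sub, map_sub, map_zero]
      linear_combination this)
    exact (Prod.ext (sub_eq_zero.mp h1) (sub_eq_zero.mp h0)).symm
  have hεl0 : ∀ i, ε i (l i) = 0 := fun i => by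
    rw [hl, map_line (ε i) (hε i), hP0, hP2, mul_eq_zero, Polynomial.C_eq_zero]
    left
    ring
  have hx2 : ∀ i, ε i (x 2) = Polynomial.X := fun i => by rw [hε, hP2]; simp
  have hdvd : ∀ i r, ε i r = 0 ↔ l i ∣ r := fun i r => by
    refine ⟨fun hr => ?_, ?_⟩
    · refine dvd_of_map_eq_zero (u := ![-i.2, 0, 1]) (v := ![-i.1, 1, 0])
        (fun h => ?_) hcx hgen (l i) (fun j => ?_) (ε i) (hεl0 i) (hPli i) (hε i 1) (hx2 i) r hr
      · simpa using congrFun (hn _ h) 1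
      · fin_cases j
        · exact ⟨1, by simp [hl]; ring⟩
        · simp
        · simp
    · rintro ⟨m, rfl⟩
      rw [map_mul, hεl0, zero_mul]
  have hprime : ∀ i, Prime (l i) := fun i => by
    refine ⟨fun h => ?_, fun h => ?_, fun a b hab => ?_⟩
    · have := hεl (i.1 + 1, i.2) i (by rw [h, map_zero])
      simpa using congrArg Prod.fst this
    · have := (hdvd i 1).mpr h.dvd
      simp at this
    · rw [← hdvd, map_mul, mul_eq_zero] at hab
      rwa [hdvd, hdvd] at hab
  refine prod_pow_dvd _ l 2 hprime (fun i j h => hεl i j ((hdvd i _).mpr h)) fun i => ?_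
  have hεx : (fun j => ε i (x j)) =
      (Polynomial.X : Polynomial K) • fun j => Polynomial.C (P i j) := by
    ext1 j
    rw [hε, Pi.smul_apply, smul_eq_mul, mul_comm]
  have hεr : ∀ j, ε i (thirdPoint c x j) = Polynomial.X ^ (2 * Fintype.card F + 2) *
      Polynomial.C (thirdPoint c (P i) j) := fun j => by
    rw [map_thirdPoint, hεx, thirdPoint_smul, Pi.smul_apply, smul_eq_mul]
    congr 1
    exact (map_thirdPoint ((Polynomial.CAlgHom (R := K) (A := K)).restrictScalars F) (P i) j).symm
  have hεz : ∀ j, ε i (z j) = Polynomial.X ^ (Fintype.card F * Fintype.card F) *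
      Polynomial.C (((P i ^ Fintype.card F) ^ Fintype.card F) j) := fun j => by
    simp only [hz, Pi.pow_apply, map_pow, hε]
    ring
  refine sq_dvd_cubD c (cub_thirdPoint hcx) hcz (hprime i) (fun h => ?_) fun j => ?_
  · have := (hdvd i _).mpr h
    rw [hεz] at this
    simp [hP2] at this
  · rw [← hdvd, map_sub, map_mul, map_mul, hεr, hεr, hεz, hεz]
    have hpar : thirdPoint c (P i) j * ((P i ^ Fintype.card F) ^ Fintype.card F) 2 =
        thirdPoint c (P i) 2 * ((P i ^ Fintype.card F) ^ Fintype.card F) j := by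
      obtain ⟨-, h1, h2⟩ := hPpar i
      fin_cases j
      · exact h1
      · exact h2
      · rfl
    have := congrArg Polynomial.C hpar
    simp only [Polynomial.C_mul] at this
    linear_combination Polynomial.X ^ (2 * Fintype.card F + 2) *
      Polynomial.X ^ (Fintype.card F * Fintype.card F) * this

theorem cubD_thirdPoint_eq_zero [IsAlgClosed K] {R : Type*} [CommRing R] [IsDomain R]
    [Algebra F R] {c : Fin 10 → F} (hF : 7 ≤ Fintype.card F)
    (hc : NoLine K c) (hn : ∀ O : Fin 3 → F, cub c O = 0 → O = 0) {x : Fin 3 → R}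
    (hcx : cub c x = 0) (hgen : ∀ r : R, ∃ f : MvPolynomial (Fin 3) F, aeval x f = r)
    (hlift : ∀ P : Fin 3 → K, cub c P = 0 →
      ∃ ε : R →ₐ[F] Polynomial K, ∀ i, ε (x i) = Polynomial.C (P i) * Polynomial.X)
    (P : Fin 3 → K) (hP : cub c P = 0) :
    cubD c (thirdPoint c P) ((P ^ Fintype.card F) ^ Fintype.card F) = 0 := by
  obtain ⟨m, hm⟩ := sq_line_dvd_cubD_thirdPoint hc hn hcx hgen hlift
  obtain ⟨ε, hε⟩ := hlift P hP
  have hεx : (fun j => ε (x j)) = (Polynomial.X : Polynomial K) • fun j => Polynomial.C (P j) := by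
    ext1 j
    rw [hε, Pi.smul_apply, smul_eq_mul, mul_comm]
  have h1 : ε (cubD c (thirdPoint c x) ((x ^ Fintype.card F) ^ Fintype.card F)) =
      Polynomial.X ^ (2 * (2 * Fintype.card F + 2) + Fintype.card F * Fintype.card F) *
        Polynomial.C (cubD c (thirdPoint c P) ((P ^ Fintype.card F) ^ Fintype.card F)) := by
    rw [map_cubD_thirdPoint, hεx, cubD_thirdPoint_smul]
    congr 1
    exact (map_cubD_thirdPoint ((Polynomial.CAlgHom (R := K) (A := K)).restrictScalars F) P).symm
  have h2 := congrArg ε hm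
  generalize cubD c (thirdPoint c P) ((P ^ Fintype.card F) ^ Fintype.card F) = v at h1 ⊢
  rw [h1, map_mul, map_prod] at h2
  simp only [map_pow, map_line ε hε, mul_pow, Finset.prod_mul_distrib, Finset.prod_const,
    Finset.card_univ, Fintype.card_prod, ← pow_mul] at h2
  have h3 : (Polynomial.X : Polynomial K) ^ (2 * (Fintype.card F * Fintype.card F)) ∣
      Polynomial.X ^ (2 * (2 * Fintype.card F + 2) + Fintype.card F * Fintype.card F) *
        Polynomial.C v := by
    rw [h2]
    exact (dvd_mul_left _ _).mul_right _
  rw [Polynomial.X_pow_dvd_iff] at h3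
  simpa using h3 (2 * (2 * Fintype.card F + 2) + Fintype.card F * Fintype.card F) (by nlinarith)

end

theorem exists_homogeneous_coordinate_ring {F K : Type*} [Field F] [Field K] [Algebra F K]
    {c : Fin 10 → F} (hirr : Irreducible (cub c (X : Fin 3 → MvPolynomial (Fin 3) K))) :
    ∃ I : Ideal (MvPolynomial (Fin 3) F), I.IsPrime ∧
      cub c (fun i => Ideal.Quotient.mk I (X i)) = 0 ∧
      ∀ P : Fin 3 → K, cub c P = 0 → ∃ ε : (MvPolynomial (Fin 3) F ⧸ I) →ₐ[F] Polynomial K,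
        ∀ i, ε (Ideal.Quotient.mk I (X i)) = Polynomial.C (P i) * Polynomial.X := by
  set g := cub c (X : Fin 3 → MvPolynomial (Fin 3) K) with hg
  have hp : (Ideal.span {g}).IsPrime := (Ideal.span_singleton_prime hirr.ne_zero).mpr hirr.prime
  set I := (Ideal.span {g}).comap (MvPolynomial.mapAlgHom (Algebra.ofId F K)) with hI
  refine ⟨I, Ideal.comap_isPrime _ _, ?_, fun P hP => ?_⟩
  · have h1 := map_cub c (Ideal.Quotient.mkₐ F I) X
    simp only [Ideal.Quotient.mkₐ_eq_mk] at h1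
    rw [← h1, Ideal.Quotient.eq_zero_iff_mem, hI, Ideal.mem_comap, map_cub]
    simp [← hg]
  · set y : Fin 3 → Polynomial K := fun i => Polynomial.C (P i) * Polynomial.X with hy
    refine ⟨Ideal.Quotient.liftₐ I (aeval y) fun f hf => ?_, fun i => ?_⟩
    · rw [hI, Ideal.mem_comap, Ideal.mem_span_singleton] at hf
      obtain ⟨h, hh⟩ := hf
      have h1 : aeval y (MvPolynomial.mapAlgHom (Algebra.ofId F K) f) = aeval y f :=
        aeval_map_algebraMap K y f
      have h2 : aeval y g = 0 := by
        have h3 := map_cub c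
          ((aeval y : MvPolynomial (Fin 3) K →ₐ[K] Polynomial K).restrictScalars F) X
        have h4 := map_cub c ((Polynomial.CAlgHom (R := K) (A := K)).restrictScalars F) P
        have h5 : y = (Polynomial.X : Polynomial K) • fun i => Polynomial.C (P i) := by
          ext1 i
          rw [hy, Pi.smul_apply, smul_eq_mul, mul_comm]
        simp only [AlgHom.restrictScalars_apply, aeval_X, hP, map_zero] at h3 h4
        rw [hg, h3, h5, cub_smul]
        exact (mul_eq_zero_of_right _ h4.symm)
      rw [← h1, hh, map_mul, h2, zero_mul]
    · exact (Ideal.Quotient.liftₐ_apply ..).trans (aeval_X ..)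

section
variable {F K : Type*} [Field F] [Fintype F] [Field K] [Algebra F K]

theorem exists_cub_eq_zero_of_irreducible [IsAlgClosed K] {c : Fin 10 → F}
    (hF : 7 ≤ Fintype.card F) (hirr : Irreducible (cub c (X : Fin 3 → MvPolynomial (Fin 3) K)))
    (hc : NoLine K c) : ∃ O : Fin 3 → F, O ≠ 0 ∧ cub c O = 0 := by
  by_contra! hcon
  have hn : ∀ O : Fin 3 → F, cub c O = 0 → O = 0 := fun O hO => by
    by_contra h
    exact hcon O h hO
  obtain ⟨I, hI, hcx, hlift⟩ := exists_homogeneous_coordinate_ring hirr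
  have hgen : ∀ r : MvPolynomial (Fin 3) F ⧸ I, ∃ f : MvPolynomial (Fin 3) F,
      aeval (fun i => Ideal.Quotient.mk I (X i)) f = r := fun r => by
    obtain ⟨f, rfl⟩ := Ideal.Quotient.mk_surjective r
    refine ⟨f, ?_⟩
    have := comp_aeval_apply (X : Fin 3 → MvPolynomial (Fin 3) F) (Ideal.Quotient.mkₐ F I) f
    simpa using this.symm
  have hthird := cubD_thirdPoint_eq_zero hF hc hn hcx hgen hlift
  have hn0 : Fintype.card F ≠ 0 := Fintype.card_ne_zero
  have hcub : ∀ w : Fin 3 → K,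
      eval w (cub c (X : Fin 3 → MvPolynomial (Fin 3) K)) = cub c w := fun w => by
    have := map_cub c ((aeval w : MvPolynomial (Fin 3) K →ₐ[K] K).restrictScalars F) X
    simpa using this
  have hcubD : ∀ w : Fin 3 → K, eval w (cubD c (X : Fin 3 → MvPolynomial (Fin 3) K)
      (X ^ Fintype.card F)) = cubD c w (w ^ Fintype.card F) := fun w => by
    have := map_cubD c ((aeval w : MvPolynomial (Fin 3) K →ₐ[K] K).restrictScalars F) X
      (X ^ Fintype.card F)
    simpa [Pi.pow_def] using this
  obtain ⟨P, hP0, hP, hα⟩ := exists_ne_zero_eval_eq_zero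
    (cub c (X : Fin 3 → MvPolynomial (Fin 3) K)) (cubD c X (X ^ Fintype.card F))
    (by rw [hcub]; simp [cub]) (by rw [hcubD]; simp [cubD])
  rw [hcub] at hP
  rw [hcubD] at hα
  have hpar := not_par_pow_card hn hP0 hP
  have hpar2 := not_par_pow_card_pow_card hc hn hP0 hP
  have hT := hthird P hP
  have hP'0 : P ^ Fintype.card F ≠ 0 := fun h => hP0 (by
    ext i
    exact pow_eq_zero_iff hn0 |>.mp (congrFun h i))
  have hP' : cub c (P ^ Fintype.card F) = 0 := by rw [cub_pow_card, hP, zero_pow hn0]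
  have hP'' : cub c ((P ^ Fintype.card F) ^ Fintype.card F) = 0 := by
    rw [cub_pow_card, hP', zero_pow hn0]
  have hpar' := not_par_pow_card hn hP'0 hP'
  have hβ : cubD c (P ^ Fintype.card F) P ≠ 0 := fun h => hpar (hc _ _ hP' hP h hα)
  rw [thirdPoint, hα, zero_smul, sub_zero, cubD_smul_left] at hT
  have hγ := (mul_eq_zero.mp hT).resolve_left (pow_ne_zero 2 hβ)
  have hlin : ∀ u w : Fin 3 → K, cubD c u w = cubD c u (Pi.single 0 1) * w 0 +
      cubD c u (Pi.single 1 1) * w 1 + cubD c u (Pi.single 2 1) * w 2 := fun u w => by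
    simp [cubD]
  have hgrad : ∃ i, cubD c P (Pi.single i 1) ≠ 0 := by
    by_contra! h
    refine hβ ?_
    have : ∀ i, cubD c (P ^ Fintype.card F) (Pi.single i 1) = 0 := fun i => by
      have h1 := cubD_pow_card c P (Pi.single i 1)
      have h2 : (Pi.single i 1 : Fin 3 → K) ^ Fintype.card F = Pi.single i 1 := by
        ext j
        by_cases hj : j = i <;> simp [hj, hn0]
      rwa [h i, h2, zero_pow hn0] at h1
    rw [hlin, this, this, this]
    ring
  have hδ : cubD c P P = 0 := by rw [cubD_self, hP, mul_zero]
  rw [hlin] at hα hγ hδ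
  obtain ⟨a, b, hab⟩ := exists_comb_of_cross hpar ((P ^ Fintype.card F) ^ Fintype.card F) (by
    obtain ⟨i, hi⟩ := hgrad
    apply mul_left_cancel₀ hi
    generalize (P ^ Fintype.card F) ^ Fintype.card F = w at *
    generalize P ^ Fintype.card F = v at *
    fin_cases i <;> simp only [Fin.zero_eta, Fin.mk_one, Fin.reduceFinMk]
    · linear_combination (v 1 * P 2 - v 2 * P 1) * hγ + (P 1 * w 2 - P 2 * w 1) * hα +
        (w 1 * v 2 - w 2 * v 1) * hδ
    · linear_combination (v 2 * P 0 - v 0 * P 2) * hγ + (P 2 * w 0 - P 0 * w 2) * hα +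
        (w 2 * v 0 - w 0 * v 2) * hδ
    · linear_combination (v 0 * P 1 - v 1 * P 0) * hγ + (P 0 * w 1 - P 1 * w 0) * hα +
        (w 0 * v 1 - w 1 * v 0) * hδ)
  rw [← hlin] at hα
  rw [hab] at hpar' hpar2
  rw [hab, cub_comb, hP, hP', hα] at hP''
  have h0 : a ^ 2 * b = 0 := (mul_eq_zero.mp (by linear_combination hP'')).resolve_right hβ
  rcases mul_eq_zero.mp h0 with h | h
  · rw [pow_eq_zero_iff two_ne_zero] at h
    rw [h, zero_smul, zero_add] at hpar2
    exact hpar2 (Par.smul_left _ _)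
  · rw [h, zero_smul, add_zero] at hpar'
    exact hpar' (Par.smul_left _ _)

end

theorem exists_eq_cub {F : Type*} [Field F] (g : MvPolynomial (Fin 3) F) (hg : g.IsHomogeneous 3) :
    ∃ c : Fin 10 → F, g = cub c X := by
  rw [g.as_sum]
  apply Finset.sum_induction _ (fun g => ∃ c : Fin 10 → F, g = cub c X)
  · rintro _ _ ⟨c, rfl⟩ ⟨d, rfl⟩
    exact ⟨c + d, by simp [cub]; ring⟩
  · exact ⟨0, by simp [cub]⟩
  · intro d hd
    have h3 := hg (mem_support_iff.mp hd)
    simp [Finsupp.weight_apply, Finsupp.sum_fintype, Fin.sum_univ_three] at h3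
    have h0 : d 0 ≤ 3 := by omega
    have h1 : d 1 ≤ 3 := by omega
    have h2 : d 2 = 3 - d 0 - d 1 := by omega
    rw [monomial_eq, Finsupp.prod_fintype _ _ (by simp), Fin.prod_univ_three, h2]
    generalize d 0 = m at *
    generalize d 1 = n at *
    generalize coeff d g = a
    interval_cases m <;> interval_cases n <;> first | (exfalso; omega) | skip
    · exact ⟨Pi.single 9 a, by simp [cub, MvPolynomial.algebraMap_eq]⟩
    · exact ⟨Pi.single 8 a, by simp [cub, MvPolynomial.algebraMap_eq]; try ring⟩
    · exact ⟨Pi.single 7 a, by simp [cub, MvPolynomial.algebraMap_eq]; try ring⟩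
    · exact ⟨Pi.single 6 a, by simp [cub, MvPolynomial.algebraMap_eq]⟩
    · exact ⟨Pi.single 5 a, by simp [cub, MvPolynomial.algebraMap_eq]; try ring⟩
    · exact ⟨Pi.single 4 a, by simp [cub, MvPolynomial.algebraMap_eq]; try ring⟩
    · exact ⟨Pi.single 3 a, by simp [cub, MvPolynomial.algebraMap_eq]; try ring⟩
    · exact ⟨Pi.single 2 a, by simp [cub, MvPolynomial.algebraMap_eq]; try ring⟩
    · exact ⟨Pi.single 1 a, by simp [cub, MvPolynomial.algebraMap_eq]; try ring⟩
    · exact ⟨Pi.single 0 a, by simp [cub, MvPolynomial.algebraMap_eq]⟩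

theorem hermitian_ne_zero {F : Type*} [Field F] (σ : F →+* F)
    (φ : (Fin 3 → F) →ₗ[F] (Fin 5 → F)) (hφ : Function.Injective φ) :
    (fun i j => ∑ k, φ (Pi.single i 1) k * σ (φ (Pi.single j 1) k)) ≠ (0 : Fin 3 → Fin 3 → F) := by
  intro h
  obtain ⟨ψ, hψ⟩ := LinearMap.exists_leftInverse_of_injective φ (LinearMap.ker_eq_bot.mpr hφ)
  set M := LinearMap.toMatrix' φ with hM
  set N := LinearMap.toMatrix' ψ with hN
  have h1 : N * M = 1 := by
    rw [hM, hN, ← LinearMap.toMatrix'_comp, hψ, LinearMap.toMatrix'_id]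
  have h2 : N.map σ * M.map σ = 1 := by
    rw [← Matrix.map_mul, h1, Matrix.map_one _ (map_zero σ) (map_one σ)]
  have h3 : M.transpose * M.map σ = 0 := by
    ext i j
    have := congrFun (congrFun h i) j
    simpa [Matrix.mul_apply, hM, LinearMap.toMatrix'_apply, Pi.single_apply] using this
  have r1 : 3 ≤ M.rank := by
    have := Matrix.rank_mul_le_right N M
    rw [h1, Matrix.rank_one] at this
    simpa using this
  have r2 : 3 ≤ (M.map σ).rank := by
    have := Matrix.rank_mul_le_right (N.map σ) (M.map σ)
    rw [h2, Matrix.rank_one] at this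
    simpa using this
  have := Matrix.rank_add_rank_le_card_of_mul_eq_zero h3
  rw [Matrix.rank_transpose] at this
  simp at this
  omega

theorem sum_sum_mul_mul {F ι κ : Type*} [CommRing F] [Fintype ι] [Fintype κ] (A B : ι → κ → F)
    (y z : ι → F) :
    ∑ i, ∑ j, (∑ k, A i k * B j k) * y i * z j
      = ∑ k, (∑ i, y i * A i k) * (∑ j, z j * B j k) := by
  simp only [Finset.sum_mul]
  rw [Finset.sum_comm (s := Finset.univ (α := κ))]
  refine Finset.sum_congr rfl fun i _ => ?_
  rw [Finset.sum_comm]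
  exact Finset.sum_congr rfl fun k _ => by
    rw [Finset.mul_sum]
    exact Finset.sum_congr rfl fun j _ => by ring

theorem exists_tangent_line (q : ℕ) (hq : IsPrimePow q)
    (F : Type) [Field F] [Fintype F] (hF : Fintype.card F = q ^ 2)
    (K : Type) [Field K] [Algebra F K]
    (hcore : ∀ (c : Fin 10 → F) (a : Fin 3 → Fin 3 → F),
      Irreducible (cub c (X : Fin 3 → MvPolynomial (Fin 3) K)) →
      (cub c (X : Fin 3 → MvPolynomial (Fin 3) K)).IsHomogeneous 3 → a ≠ 0 →
      ∃ y : Fin 3 → F, cub c y = 0 ∧ ∑ i, ∑ j, a i j * y i * y j ^ q ≠ 0)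
    (G : MvPolynomial (Fin 5) F) (hGd : G.IsHomogeneous 3)
    (P : P4 F) (hP : P ∈ VG G ∩ hermV3 q F)
    (Pl : Set (P4 F)) (W : Submodule F (Fin 5 → F))
    (hPl : Pl = {x : P4 F | x.submodule ≤ W})
    (hPlT : Pl ⊆ tangentHyp q P) (hPnot : P ∉ Pl)
    (φ : (Fin 3 → F) →ₗ[F] (Fin 5 → F)) (hφinj : Function.Injective φ)
    (hφrange : LinearMap.range φ = W)
    (habs : Irreducible (MvPolynomial.map (algebraMap F K)
      (aeval (fun j : Fin 5 =>
        ∑ i : Fin 3, C (φ (Pi.single i 1) j) * (X i : MvPolynomial (Fin 3) F)) G)))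
    (hcone : VG G ∩ tangentHyp q P = {P} ∪ ⋃ s ∈ VG G ∩ Pl, lineThrough P s) :
    ∃ ℓ : Set (P4 F), IsLine F ℓ ∧ P ∈ ℓ ∧ ℓ ⊆ VG G ∧ ℓ ∩ hermV3 q F = {P} := by
  obtain ⟨σ, hσ⟩ := exists_frobenius_algebra q hq F hF F
  have hσσ : ∀ x, σ (σ x) = x := fun x => by
    rw [hσ, hσ, ← pow_mul, ← sq, ← hF, FiniteField.pow_card]
  set g := aeval (fun j : Fin 5 =>
        ∑ i : Fin 3, C (φ (Pi.single i 1) j) * (X i : MvPolynomial (Fin 3) F)) G with hg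
  have hφy : ∀ (y : Fin 3 → F) j, φ y j = ∑ i, y i * φ (Pi.single i 1) j := fun y j => by
    have : y = ∑ i, y i • (Pi.single i 1 : Fin 3 → F) := by
      ext; simp [Finset.sum_apply, Pi.single_apply]
    conv_lhs => rw [this]
    simp [Finset.sum_apply]
  have hgh : g.IsHomogeneous 3 := by
    have := hGd.aeval (n := 1) (fun j : Fin 5 =>
        ∑ i : Fin 3, C (φ (Pi.single i 1) j) * (X i : MvPolynomial (Fin 3) F))
        (fun j => IsHomogeneous.sum _ _ _ fun i _ => by
          simpa using (isHomogeneous_C (Fin 3) (φ (Pi.single i 1) j)).mul (isHomogeneous_X F i))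
    exact this
  have hev : ∀ y, eval y g = eval (φ y) G := fun y => by
    rw [hg, ← MvPolynomial.coe_aeval_eq_eval, ← MvPolynomial.coe_aeval_eq_eval]
    simp only [RingHom.coe_coe]
    rw [← AlgHom.comp_apply, MvPolynomial.comp_aeval]
    congr 2
    ext j
    simp [hφy y j, mul_comm]
  obtain ⟨c, hc⟩ := exists_eq_cub g hgh
  have hcev : ∀ y, eval y g = cub c y := fun y => by
    rw [hc, ← MvPolynomial.coe_aeval_eq_eval]
    simpa using map_cub c (aeval y : MvPolynomial (Fin 3) F →ₐ[F] F) X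
  have hmap : MvPolynomial.map (algebraMap F K) g = cub c X := by
    rw [hc]
    simp [cub, MvPolynomial.algebraMap_apply]
  obtain ⟨y, hy0, hyS⟩ := hcore c (fun i j => ∑ k, φ (Pi.single i 1) k * σ (φ (Pi.single j 1) k))
    (hmap ▸ habs) (hmap ▸ hgh.map _) (hermitian_ne_zero σ φ hφinj)
  have hS : ∑ i, ∑ j, (∑ k, φ (Pi.single i 1) k * σ (φ (Pi.single j 1) k)) * y i * y j ^ q
      = ∑ k, φ y k * σ (φ y k) := by
    simp only [hφy y, map_sum, map_mul, ← hσ]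
    exact sum_sum_mul_mul _ _ _ _
  rw [hS] at hyS
  set w := φ y with hw
  have hw0 : w ≠ 0 := by rintro h; simp [h] at hyS
  set s : P4 F := Projectivization.mk F w hw0 with hs
  obtain ⟨t, ht⟩ := Projectivization.exists_smul_eq_mk_rep F w hw0
  rw [← hs, Units.smul_def] at ht
  have hwW : w ∈ W := hφrange ▸ LinearMap.mem_range_self φ y
  have hsPl : s ∈ Pl := by
    rw [hPl, Set.mem_ofPred_eq, hs, Projectivization.submodule_mk]
    simpa using hwW
  have hsVG : s ∈ VG G := by
    change eval s.rep G = 0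
    rw [← ht, ← map_smul φ, ← hev, hcev, cub_smul, hy0, mul_zero]
  have hsT : ∑ k, P.rep k ^ q * w k = 0 := by
    have : ∑ k, P.rep k ^ q * s.rep k = 0 := hPlT hsPl
    rw [← ht] at this
    have h2 : (t : F) * ∑ k, P.rep k ^ q * w k = 0 := by
      rw [← this, Finset.mul_sum]
      exact Finset.sum_congr rfl fun k _ => by simp; ring
    exact (mul_eq_zero.mp h2).resolve_left t.ne_zero
  have hsT' : ∑ k, P.rep k * σ (w k) = 0 := by
    have := congrArg σ hsT
    simpa [map_sum, ← hσ, hσσ] using this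
  have hPP : ∑ k, P.rep k * σ (P.rep k) = 0 := by
    rw [← show ∑ k, P.rep k ^ (q + 1) = 0 from hP.2]
    exact Finset.sum_congr rfl fun k _ => by rw [hσ]; ring
  have hsub : s.submodule = F ∙ w := Projectivization.submodule_mk w hw0
  have hPsub : P.submodule = F ∙ P.rep := Projectivization.submodule_eq P
  refine ⟨lineThrough P s, ⟨P.submodule ⊔ s.submodule, ?_, rfl⟩, ?_, ?_, ?_⟩
  · have hinf : P.submodule ⊓ s.submodule = ⊥ := by
      rw [Submodule.eq_bot_iff]
      intro x hx
      rw [Submodule.mem_inf, hPsub, hsub] at hx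
      obtain ⟨⟨a, rfl⟩, hx2⟩ := And.imp_left Submodule.mem_span_singleton.mp hx
      by_contra hax
      have ha : a ≠ 0 := fun h => hax (by simp [h])
      apply hPnot
      rw [hPl, Set.mem_ofPred_eq, hPsub, Submodule.span_singleton_le_iff_mem]
      have h1 : a • P.rep ∈ W := (Submodule.span_singleton_le_iff_mem _ _).mpr hwW hx2
      simpa [ha] using W.smul_mem a⁻¹ h1
    have := Submodule.finrank_sup_add_finrank_inf_eq P.submodule s.submodule
    rw [hinf, finrank_bot, P.finrank_submodule, s.finrank_submodule] at this
    exact this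
  · exact (le_sup_left : P.submodule ≤ P.submodule ⊔ s.submodule)
  · have : lineThrough P s ⊆ VG G ∩ tangentHyp q P := by
      rw [hcone]
      exact fun x hx => Or.inr (Set.mem_biUnion (show s ∈ VG G ∩ Pl from ⟨hsVG, hsPl⟩) hx)
    exact fun x hx => (this hx).1
  · ext x
    constructor
    · rintro ⟨hx1, hx2⟩
      have hxm : x.rep ∈ P.submodule ⊔ s.submodule := hx1 (by
        rw [Projectivization.submodule_eq]; exact Submodule.mem_span_singleton_self _)
      rw [hPsub, hsub, Submodule.mem_sup] at hxm
      obtain ⟨_, ha, _, hb, hab⟩ := hxm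
      obtain ⟨a, rfl⟩ := Submodule.mem_span_singleton.mp ha
      obtain ⟨b, rfl⟩ := Submodule.mem_span_singleton.mp hb
      have hx3 : ∑ k, x.rep k ^ (q + 1) = 0 := hx2
      have h4 : ∑ k, x.rep k ^ (q + 1) = a * σ a * ∑ k, P.rep k * σ (P.rep k)
          + a * σ b * ∑ k, P.rep k * σ (w k) + b * σ a * ∑ k, P.rep k ^ q * w k
          + b * σ b * ∑ k, w k * σ (w k) := by
        simp only [Finset.mul_sum, ← Finset.sum_add_distrib]
        refine Finset.sum_congr rfl fun k _ => ?_
        rw [pow_succ, ← hσ, ← hσ, ← hab]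
        simp
        ring
      rw [hx3, hPP, hsT, hsT'] at h4
      have hb0 : b = 0 := by
        by_contra hb0
        have : σ b ≠ 0 := (map_ne_zero σ).mpr hb0
        simp at h4
        tauto
      rw [hb0, zero_smul, add_zero] at hab
      have : x.submodule = P.submodule := by
        have ha0 : a ≠ 0 := by rintro rfl; exact x.rep_nonzero (by simp [← hab])
        rw [Projectivization.submodule_eq x, hPsub, ← hab]
        exact Submodule.span_singleton_smul_eq (IsUnit.mk0 a ha0) _
      exact Projectivization.submodule_injective this
    · rintro rfl
      exact ⟨(le_sup_left : x.submodule ≤ x.submodule ⊔ s.submodule), hP.2⟩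

theorem stmt17 (q : ℕ) (hq : IsPrimePow q) (hq7 : 7 ≤ q)
    (F : Type) [Field F] [Fintype F] (hF : Fintype.card F = q ^ 2)
    (K : Type) [Field K] [Algebra F K] [IsAlgClosure F K]
    (G : MvPolynomial (Fin 5) F) (hG : G ≠ 0) (hGd : G.IsHomogeneous 3)
    (P : P4 F) (hP : P ∈ VG G ∩ hermV3 q F)
    (Pl : Set (P4 F)) (W : Submodule F (Fin 5 → F))
    (hW : Module.finrank F W = 3) (hPl : Pl = {x : P4 F | x.submodule ≤ W})
    (hPlT : Pl ⊆ tangentHyp q P) (hPnot : P ∉ Pl)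
    (φ : (Fin 3 → F) →ₗ[F] (Fin 5 → F)) (hφinj : Function.Injective φ)
    (hφrange : LinearMap.range φ = W)
    (habs : Irreducible (MvPolynomial.map (algebraMap F K)
      (aeval (fun j : Fin 5 =>
        ∑ i : Fin 3, C (φ (Pi.single i 1) j) * (X i : MvPolynomial (Fin 3) F)) G)))
    (hcone : VG G ∩ tangentHyp q P = {P} ∪ ⋃ s ∈ VG G ∩ Pl, lineThrough P s) :
    ∃ ℓ : Set (P4 F), IsLine F ℓ ∧ P ∈ ℓ ∧ ℓ ⊆ VG G ∧ ℓ ∩ hermV3 q F = {P} := by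
  have : IsAlgClosed K := IsAlgClosure.isAlgClosed F
  refine exists_tangent_line q hq F hF K (fun c a hirr hd ha => ?_) G hGd P hP Pl W hPl hPlT hPnot φ
    hφinj hφrange habs hcone
  have hc := NoLine.of_irreducible c hirr hd
  obtain ⟨O, hO0, hO⟩ := exists_cub_eq_zero_of_irreducible (by rw [hF]; nlinarith) hirr hc
  exact existsFormNeZero_of_zero q hq hq7 hF K c hc O hO0 hO a ha
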